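/- Let H ∈ (0, 1/2), ε ∈ (0, H), H' ∈ (2H, 1), T > 0, and set R_u = u^{−2/H'} and δ_u = (ln u)²/u². Let Y_H(t, s) = B_H(t) − B_H(s). For every integer l with 1 ≤ l ≤ ⌊T/R_u⌋ and every integer k with 1 ≤ k ≤ ⌊δ_u/R_u − 1⌋, define the rectangle J'_{k,l} = [1 + (l − 1 − k) R_u, 1 + (l − k) R_u] × [(l − 1) R_u, l R_u] and u_{k+} = u / (1 − (H + ε)(k + 1) R_u). Then for all sufficiently large u and all such k, l, P( max_{(t,s) ∈ J'_{k,l}} Y_H(t, s) > u ) ≥ (1/2 − ε)^{1/H} · 𝓗_{2H}² · u_{k+}^{2/H} · R_u² · Ψ(u_{k+}). -/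

import Mathlib

open MeasureTheory ProbabilityTheory Real Filter Set

/-- Tail `Ψ(u) = P(N > u)` of a standard normal random variable. -/
noncomputable def stdNormalTail (u : ℝ) : ℝ :=
  ((ProbabilityTheory.gaussianReal 0 1) (Set.Ioi u)).toReal

/-- Supremum of `Y_H(t,s) = B_H(t) - B_H(s)` over the rectangle `[t₁,t₂] × [s₁,s₂]`. -/
noncomputable def supYOnRect {Ω : Type*} (B : ℝ → Ω → ℝ) (t₁ t₂ s₁ s₂ : ℝ) (ω : Ω) : ℝ :=
  ⨆ (t : Set.Icc t₁ t₂) (s : Set.Icc s₁ s₂), (B (t:ℝ) ω - B (s:ℝ) ω)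

/-- A finite family of real random variables which is jointly Gaussian with mean vector `m` and
covariance matrix `C`, expressed through its characteristic function. -/
structure IsGaussFam {Ω ι : Type*} [MeasurableSpace Ω] [Fintype ι] (μ : Measure Ω)
    (X : ι → Ω → ℝ) (m : ι → ℝ) (C : ι → ι → ℝ) : Prop where
  meas : ∀ i, Measurable (X i)
  charFun : ∀ c : ι → ℝ, ∫ ω, Complex.exp ((∑ i, c i * X i ω : ℝ) * Complex.I) ∂μ =
    Complex.exp ((∑ i, c i * m i : ℝ) * Complex.I - ((∑ i, ∑ j, c i * c j * C i j : ℝ) : ℂ) / 2)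

namespace IsGaussFam

variable {Ω Ω' ι κ : Type*} [MeasurableSpace Ω] [MeasurableSpace Ω'] [Fintype ι] [Fintype κ]
  {μ : Measure Ω} {μ' : Measure Ω'} {X : ι → Ω → ℝ} {X' : ι → Ω' → ℝ}
  {m m' : ι → ℝ} {C C' : ι → ι → ℝ}

lemma congr (h : IsGaussFam μ X m C) (hm : ∀ i, m i = m' i) (hC : ∀ i j, C i j = C' i j) :
    IsGaussFam μ X m' C' := by
  obtain rfl : m = m' := funext hm
  obtain rfl : C = C' := funext fun i => funext (hC i)
  exact h

/-- Affine images of Gaussian families are Gaussian families. -/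
lemma affine (h : IsGaussFam μ X m C) (A : κ → ι → ℝ) (b : κ → ℝ) :
    IsGaussFam μ (fun k ω => ∑ i, A k i * X i ω + b k) (fun k => ∑ i, A k i * m i + b k)
      (fun k l => ∑ i, ∑ j, A k i * A l j * C i j) where
  meas k := by
    have := h.meas
    fun_prop
  charFun c := by
    have h1 : ∀ f : ι → ℝ, ∑ k, c k * (∑ i, A k i * f i + b k)
        = ∑ i, (∑ k, c k * A k i) * f i + ∑ k, c k * b k := by
      intro f
      simp only [mul_add, Finset.sum_add_distrib, Finset.mul_sum, Finset.sum_mul]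
      rw [Finset.sum_comm]
      simp only [mul_assoc]
    have h2 : ∑ k, ∑ l, c k * c l * ∑ i, ∑ j, A k i * A l j * C i j
        = ∑ i, ∑ j, (∑ k, c k * A k i) * (∑ l, c l * A l j) * C i j := by
      simp only [Finset.mul_sum, Finset.sum_mul]
      calc _ = ∑ k, ∑ i, ∑ l, ∑ j, c k * c l * (A k i * A l j * C i j) :=
            Finset.sum_congr rfl fun k _ => Finset.sum_comm
        _ = ∑ i, ∑ k, ∑ l, ∑ j, c k * c l * (A k i * A l j * C i j) := Finset.sum_comm
        _ = ∑ i, ∑ k, ∑ j, ∑ l, c k * c l * (A k i * A l j * C i j) :=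
            Finset.sum_congr rfl fun i _ => Finset.sum_congr rfl fun k _ => Finset.sum_comm
        _ = ∑ i, ∑ j, ∑ k, ∑ l, c k * c l * (A k i * A l j * C i j) :=
            Finset.sum_congr rfl fun i _ => Finset.sum_comm
        _ = ∑ i, ∑ j, ∑ l, ∑ k, c k * c l * (A k i * A l j * C i j) :=
            Finset.sum_congr rfl fun i _ => Finset.sum_congr rfl fun k _ => Finset.sum_comm
        _ = _ := by
            refine Finset.sum_congr rfl fun i _ => Finset.sum_congr rfl fun j _ =>
              Finset.sum_congr rfl fun k _ => Finset.sum_congr rfl fun l _ => ?_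
            ring
    simp only [h1, h2]
    simp only [Complex.ofReal_add, add_mul, Complex.exp_add]
    rw [integral_mul_const, h.charFun fun i => ∑ k, c k * A k i, ← Complex.exp_add]
    congr 1
    ring

/-- The sum of two independent Gaussian families, realised on the product space. -/
lemma prod_add [SFinite μ] [SFinite μ'] (h : IsGaussFam μ X m C) (h' : IsGaussFam μ' X' m' C') :
    IsGaussFam (μ.prod μ') (fun i p => X i p.1 + X' i p.2) (fun i => m i + m' i)
      (fun i j => C i j + C' i j) where
  meas i := ((h.meas i).comp measurable_fst).add ((h'.meas i).comp measurable_snd)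
  charFun c := by
    simp only [mul_add, Finset.sum_add_distrib, Complex.ofReal_add, add_mul, Complex.exp_add]
    rw [integral_prod_mul (μ := μ) (ν := μ')
      (fun ω => Complex.exp ((∑ i, c i * X i ω : ℝ) * Complex.I))
      (fun ω => Complex.exp ((∑ i, c i * X' i ω : ℝ) * Complex.I)), h.charFun, h'.charFun,
      ← Complex.exp_add]
    congr 1
    ring

lemma charFun_map_toLp (h : IsGaussFam μ X m C) (c : EuclideanSpace ℝ ι) :
    MeasureTheory.charFun (μ.map fun ω => WithLp.toLp 2 fun i => X i ω) c =
      Complex.exp ((∑ i, c i * m i : ℝ) * Complex.I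
        - ((∑ i, ∑ j, c i * c j * C i j : ℝ) : ℂ) / 2) := by
  have hm : Measurable fun ω => (WithLp.toLp 2 fun i => X i ω : EuclideanSpace ℝ ι) :=
    (WithLp.measurable_toLp 2 (ι → ℝ)).comp (measurable_pi_lambda _ h.meas)
  rw [charFun_apply, integral_map hm.aemeasurable (by fun_prop), ← h.charFun c]
  refine integral_congr_ae (Eventually.of_forall fun ω => ?_)
  simp [PiLp.inner_apply]

/-- The law of a Gaussian family is determined by its mean and its covariance. -/
lemma measure_eq [IsFiniteMeasure μ] [IsFiniteMeasure μ'] (h : IsGaussFam μ X m C)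
    (h' : IsGaussFam μ' X' m C) {S : Set (ι → ℝ)} (hS : MeasurableSet S) :
    μ {ω | (fun i => X i ω) ∈ S} = μ' {ω | (fun i => X' i ω) ∈ S} := by
  have hm : Measurable fun ω => (WithLp.toLp 2 fun i => X i ω : EuclideanSpace ℝ ι) :=
    (WithLp.measurable_toLp 2 (ι → ℝ)).comp (measurable_pi_lambda _ h.meas)
  have hm' : Measurable fun ω => (WithLp.toLp 2 fun i => X' i ω : EuclideanSpace ℝ ι) :=
    (WithLp.measurable_toLp 2 (ι → ℝ)).comp (measurable_pi_lambda _ h'.meas)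
  have key : μ.map (fun ω => (WithLp.toLp 2 fun i => X i ω : EuclideanSpace ℝ ι))
      = μ'.map (fun ω => (WithLp.toLp 2 fun i => X' i ω : EuclideanSpace ℝ ι)) := by
    refine Measure.ext_of_charFun (funext fun c => ?_)
    rw [h.charFun_map_toLp, h'.charFun_map_toLp]
  have hS' : MeasurableSet {x : EuclideanSpace ℝ ι | WithLp.ofLp x ∈ S} :=
    WithLp.measurable_ofLp 2 (ι → ℝ) hS
  have := congrArg (fun ν => ν {x : EuclideanSpace ℝ ι | WithLp.ofLp x ∈ S}) key
  simp only [Measure.map_apply hm hS', Measure.map_apply hm' hS'] at this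
  exact this

lemma le_liminf_measure [IsProbabilityMeasure μ] [IsProbabilityMeasure μ']
    {Y : ℕ → ι → Ω → ℝ} {mn : ℕ → ι → ℝ} {Cn : ℕ → ι → ι → ℝ}
    (h : ∀ n, IsGaussFam μ (Y n) (mn n) (Cn n)) (h' : IsGaussFam μ' X' m C)
    (hm : ∀ i, Tendsto (fun n => mn n i) atTop (nhds (m i)))
    (hC : ∀ i j, Tendsto (fun n => Cn n i j) atTop (nhds (C i j)))
    {S : Set (ι → ℝ)} (hS : IsOpen S) :
    μ' {ω | (fun i => X' i ω) ∈ S} ≤ liminf (fun n => μ {ω | (fun i => Y n i ω) ∈ S}) atTop := by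
  have hmn : ∀ n, Measurable fun ω => (WithLp.toLp 2 fun i => Y n i ω : EuclideanSpace ℝ ι) :=
    fun n => (WithLp.measurable_toLp 2 (ι → ℝ)).comp (measurable_pi_lambda _ (h n).meas)
  have hm' : Measurable fun ω => (WithLp.toLp 2 fun i => X' i ω : EuclideanSpace ℝ ι) :=
    (WithLp.measurable_toLp 2 (ι → ℝ)).comp (measurable_pi_lambda _ h'.meas)
  let P : ℕ → ProbabilityMeasure (EuclideanSpace ℝ ι) := fun n =>
    ⟨μ.map (fun ω => WithLp.toLp 2 fun i => Y n i ω),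
      Measure.isProbabilityMeasure_map (hmn n).aemeasurable⟩
  let P' : ProbabilityMeasure (EuclideanSpace ℝ ι) :=
    ⟨μ'.map (fun ω => WithLp.toLp 2 fun i => X' i ω),
      Measure.isProbabilityMeasure_map hm'.aemeasurable⟩
  have hP : Tendsto P atTop (nhds P') := by
    refine ProbabilityMeasure.tendsto_of_tendsto_charFun fun c => ?_
    change Tendsto (fun n => MeasureTheory.charFun
      (μ.map fun ω => WithLp.toLp 2 fun i => Y n i ω) c) atTop
      (nhds (MeasureTheory.charFun (μ'.map fun ω => WithLp.toLp 2 fun i => X' i ω) c))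
    simp only [(h _).charFun_map_toLp, h'.charFun_map_toLp]
    refine (Complex.continuous_exp.tendsto _).comp ?_
    refine Tendsto.sub (Tendsto.mul_const _ ?_) (Tendsto.div_const ?_ _)
    · exact (Complex.continuous_ofReal.tendsto _).comp
        (tendsto_finsetSum _ fun i _ => (hm i).const_mul _)
    · exact (Complex.continuous_ofReal.tendsto _).comp
        (tendsto_finsetSum _ fun i _ => tendsto_finsetSum _ fun j _ => (hC i j).const_mul _)
  have hS' : IsOpen {x : EuclideanSpace ℝ ι | WithLp.ofLp x ∈ S} :=
    hS.preimage (PiLp.continuous_ofLp 2 _)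
  have := ProbabilityMeasure.le_liminf_measure_open_of_tendsto hP hS'
  simp only [P, P', ProbabilityMeasure.coe_mk, Measure.map_apply (hmn _) hS'.measurableSet,
    Measure.map_apply hm' hS'.measurableSet] at this
  exact this

lemma quadForm_nonneg [IsProbabilityMeasure μ] (h : IsGaussFam μ X m C) (c : ι → ℝ) :
    0 ≤ ∑ i, ∑ j, c i * c j * C i j := by
  have h1 := congrArg norm (h.charFun c)
  have h2 : ‖∫ ω, Complex.exp ((∑ i, c i * X i ω : ℝ) * Complex.I) ∂μ‖ ≤ 1 := by
    refine (norm_integral_le_integral_norm _).trans ?_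
    simp only [Complex.norm_exp_ofReal_mul_I]
    simp
  rw [h1, Complex.norm_exp] at h2
  have h3 := Real.exp_le_one_iff.1 h2
  simp only [Complex.sub_re, Complex.mul_re, Complex.ofReal_re, Complex.I_re, mul_zero,
    Complex.ofReal_im, Complex.I_im, mul_one, sub_self, Complex.div_ofNat_re] at h3
  linarith

/-- Linear combinations of a Gaussian family are real Gaussian variables. -/
lemma map_sum [IsProbabilityMeasure μ] (h : IsGaussFam μ X m C) (c : ι → ℝ) :
    μ.map (fun ω => ∑ i, c i * X i ω) =
      gaussianReal (∑ i, c i * m i) (∑ i, ∑ j, c i * c j * C i j).toNNReal := by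
  have hm : Measurable fun ω => ∑ i, c i * X i ω := by
    have := h.meas
    fun_prop
  refine Measure.ext_of_charFun (funext fun t => ?_)
  rw [charFun_gaussianReal, charFun_apply_real, integral_map hm.aemeasurable (by fun_prop)]
  have h1 := h.charFun fun i => t * c i
  have h2 : ∑ i, ∑ j, t * c i * (t * c j) * C i j = t ^ 2 * ∑ i, ∑ j, c i * c j * C i j := by
    simp only [Finset.mul_sum]
    exact Finset.sum_congr rfl fun i _ => Finset.sum_congr rfl fun j _ => by ring
  have h3 : ∀ f : ι → ℝ, ∑ i, t * c i * f i = t * ∑ i, c i * f i := fun f => by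
    simp only [Finset.mul_sum, mul_assoc]
  simp only [h2, h3] at h1
  have h4 : (((∑ i, ∑ j, c i * c j * C i j).toNNReal : ℝ) : ℂ)
      = ((∑ i, ∑ j, c i * c j * C i j : ℝ) : ℂ) := by
    rw [Real.coe_toNNReal _ (h.quadForm_nonneg c)]
  rw [h4]
  simp only [Complex.ofReal_mul, Complex.ofReal_pow] at h1
  rw [h1]
  ring_nf

/-- Exponential moments of a Gaussian family. -/
lemma lintegral_exp [IsProbabilityMeasure μ] (h : IsGaussFam μ X m C) (c : ι → ℝ) :
    ∫⁻ ω, ENNReal.ofReal (Real.exp (∑ i, c i * X i ω)) ∂μ =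
      ENNReal.ofReal (Real.exp (∑ i, c i * m i + (∑ i, ∑ j, c i * c j * C i j) / 2)) := by
  have hm : Measurable fun ω => ∑ i, c i * X i ω := by
    have := h.meas
    fun_prop
  have h1 := mgf_gaussianReal (h.map_sum c) 1
  have h2 : Integrable (fun x : ℝ => Real.exp (1 * x)) (μ.map (fun ω => ∑ i, c i * X i ω)) := by
    rw [h.map_sum c]
    exact integrable_exp_mul_gaussianReal 1
  have h3 := (integrable_map_measure (by fun_prop) hm.aemeasurable).1 h2
  simp only [one_mul, Function.comp_def] at h3
  rw [← ofReal_integral_eq_lintegral_ofReal h3 (Eventually.of_forall fun _ => (Real.exp_pos _).le)]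
  simp only [mgf, one_mul, mul_one, one_pow, Real.coe_toNNReal _ (h.quadForm_nonneg c)] at h1
  rw [h1]

end IsGaussFam

/-- The part of the definition of fractional Brownian motion which is used below. -/
structure IsFbm {Ω : Type*} [MeasurableSpace Ω] (μ : Measure Ω) (H : ℝ) (B : ℝ → Ω → ℝ) : Prop where
  meas : ∀ t : ℝ, Measurable (B t)
  cont : ∀ᵐ ω ∂μ, Continuous fun t => B t ω
  gauss : ∀ (n : ℕ) (c : Fin n → ℝ) (t : Fin n → ℝ),
    ∃ v : NNReal, μ.map (fun ω => ∑ i, c i * B (t i) ω) = gaussianReal 0 v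
  cov : ∀ t s : ℝ, 0 ≤ t → 0 ≤ s →
    ∫ ω, B t ω * B s ω ∂μ = (t ^ (2*H) + s ^ (2*H) - |t - s| ^ (2*H)) / 2

/-- The values of a fractional Brownian motion at finitely many times form a Gaussian family. -/
lemma isGaussFam_fbm {Ω : Type*} [MeasurableSpace Ω] {μ : Measure Ω} {H : ℝ} {B : ℝ → Ω → ℝ}
    (hB : IsFbm μ H B)
    {ι : Type*} [Fintype ι] (t : ι → ℝ) (ht : ∀ i, 0 ≤ t i) :
    IsGaussFam μ (fun i => B (t i)) 0
      (fun i j => (t i ^ (2*H) + t j ^ (2*H) - |t i - t j| ^ (2*H)) / 2) where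
  meas i := hB.meas _
  charFun c := by
    have hmeas := hB.meas
    have hm : Measurable fun ω => ∑ i, c i * B (t i) ω := by fun_prop
    have hL2 : ∀ s, MemLp (B s) 2 μ := by
      intro s
      obtain ⟨v, hv⟩ := hB.gauss 1 (fun _ => 1) (fun _ => s)
      simp only [Finset.univ_unique, Finset.sum_singleton, one_mul] at hv
      have := memLp_id_gaussianReal (μ := 0) (v := v) 2
      rw [← hv] at this
      exact (memLp_map_measure_iff (by fun_prop) (hB.meas s).aemeasurable).1 this
    obtain ⟨v, hv⟩ := hB.gauss (Fintype.card ι) (fun j => c ((Fintype.equivFin ι).symm j))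
      (fun j => t ((Fintype.equivFin ι).symm j))
    have he : (fun ω => ∑ j, c ((Fintype.equivFin ι).symm j) * B (t ((Fintype.equivFin ι).symm j)) ω)
        = fun ω => ∑ i, c i * B (t i) ω := by
      funext ω
      exact (Fintype.equivFin ι).symm.sum_comp fun i => c i * B (t i) ω
    rw [he] at hv
    have hvar : (v : ℝ) = ∑ i, ∑ j, c i * c j * ((t i ^ (2*H) + t j ^ (2*H) - |t i - t j| ^ (2*H)) / 2) := by
      have h1 : ∫ x, x ^ 2 ∂(gaussianReal 0 v) = v := by
        have := variance_fun_id_gaussianReal (μ := 0) (v := v)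
        rwa [variance_of_integral_eq_zero (by fun_prop) (by simp)] at this
      rw [← h1, ← hv, integral_map hm.aemeasurable (by fun_prop)]
      simp only [sq, Finset.sum_mul_sum]
      have hint : ∀ i j, Integrable (fun ω => c i * B (t i) ω * (c j * B (t j) ω)) μ := fun i j =>
        ((hL2 (t i)).const_mul (c i)).integrable_mul ((hL2 (t j)).const_mul (c j))
      rw [integral_finsetSum _ fun i _ => integrable_finsetSum _ fun j _ => hint i j]
      refine Finset.sum_congr rfl fun i _ => ?_
      rw [integral_finsetSum _ fun j _ => hint i j]
      refine Finset.sum_congr rfl fun j _ => ?_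
      rw [← hB.cov _ _ (ht i) (ht j), ← integral_const_mul]
      congr 1
      funext ω
      ring
    have h2 := charFun_gaussianReal (μ := 0) (v := v) (t := 1)
    rw [← hv, charFun_apply_real, integral_map hm.aemeasurable (by fun_prop)] at h2
    rw [← hvar]
    simpa using h2

lemma ofReal_stdNormalTail (v : ℝ) :
    ENNReal.ofReal (stdNormalTail v) = gaussianReal 0 1 (Ioi v) :=
  ENNReal.ofReal_toReal (measure_ne_top _ _)

lemma stdNormalTail_pos (v : ℝ) : 0 < stdNormalTail v := by
  refine ENNReal.toReal_pos (fun h => ?_) (measure_ne_top _ _)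
  have := gaussianReal_absolutelyContinuous' 0 (v := 1) one_ne_zero h
  simp at this

lemma gaussianReal_Ioi {v : NNReal} {σ : ℝ} (hσ : 0 < σ) (hv : (v : ℝ) = σ ^ 2) (x : ℝ) :
    gaussianReal 0 v (Ioi x) = gaussianReal 0 1 (Ioi (x / σ)) := by
  have h := gaussianReal_map_const_mul (μ := 0) (v := 1) σ
  have h2 : (.mk (σ ^ 2) (sq_nonneg _) * 1 : NNReal) = v := by
    ext
    simp [hv]
  rw [mul_zero, h2] at h
  rw [← h, Measure.map_apply (by fun_prop) measurableSet_Ioi]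
  congr 1
  ext y
  simp [div_lt_iff₀' hσ]

lemma stdNormalTail_mul_le {v s : ℝ} (hv : 0 ≤ v) (hs : 1 ≤ s) :
    stdNormalTail (v * s) ≤ exp (-(v ^ 2 * (s ^ 2 - 1) / 2)) * stdNormalTail v := by
  obtain ⟨d, hd⟩ : ∃ d, d = v * s - v := ⟨_, rfl⟩
  have hd0 : 0 ≤ d := by nlinarith
  have h1 : gaussianReal 0 1 (Ioi (v * s)) = gaussianReal (-d) 1 (Ioi v) := by
    have h := gaussianReal_map_add_const (μ := 0) (v := 1) (-d)
    rw [zero_add] at h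
    rw [← h, Measure.map_apply (by fun_prop) measurableSet_Ioi]
    congr 1
    ext y
    simp only [mem_Ioi, mem_preimage]
    constructor <;> intro h <;> linarith
  have h2 : gaussianReal 0 1 (Ioi (v * s)) ≤
      ENNReal.ofReal (exp (-(v ^ 2 * (s ^ 2 - 1) / 2))) * gaussianReal 0 1 (Ioi v) := by
    rw [h1, gaussianReal_apply _ one_ne_zero, gaussianReal_apply _ one_ne_zero,
      ← lintegral_const_mul _ (measurable_gaussianPDF _ _)]
    refine setLIntegral_mono (by fun_prop) fun z hz => ?_
    rw [gaussianPDF, gaussianPDF, ← ENNReal.ofReal_mul (exp_pos _).le]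
    refine ENNReal.ofReal_le_ofReal ?_
    simp only [gaussianPDFReal]
    rw [mul_left_comm, ← exp_add]
    refine mul_le_mul_of_nonneg_left (exp_le_exp.2 ?_) (by positivity)
    have hz' : v < z := hz
    have : v ^ 2 * (s ^ 2 - 1) = (v + d) ^ 2 - v ^ 2 := by rw [hd]; ring
    rw [this]
    simp
    nlinarith [mul_nonneg hd0 (sub_nonneg.2 hz'.le)]
  rw [← ofReal_stdNormalTail, ← ofReal_stdNormalTail, ← ENNReal.ofReal_mul (exp_pos _).le] at h2
  exact (ENNReal.ofReal_le_ofReal_iff (mul_nonneg (exp_pos _).le (stdNormalTail_pos _).le)).1 h2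

lemma stdNormalTail_le_pdf_div {v : ℝ} (hv : 0 < v) :
    stdNormalTail v ≤ gaussianPDFReal 0 1 v / v := by
  have h3 : ∫ z in Ioi v, exp (-v * z) = exp (-v * v) / v := by
    rw [integral_exp_mul_Ioi (by linarith)]
    field_simp
  have h2 : gaussianReal 0 1 (Ioi v) ≤ ENNReal.ofReal (gaussianPDFReal 0 1 v / v) := by
    have : gaussianPDFReal 0 1 v / v =
        ∫ z in Ioi v, gaussianPDFReal 0 1 v * exp (v * v) * exp (-v * z) := by
      rw [integral_const_mul, h3]
      have : exp (v * v) * exp (-v * v) = 1 := by rw [← exp_add]; simp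
      rw [mul_assoc, ← mul_div_assoc, this, mul_one_div]
    rw [this, ofReal_integral_eq_lintegral_ofReal]
    · rw [gaussianReal_apply _ one_ne_zero]
      refine setLIntegral_mono (by fun_prop) fun z hz => ?_
      rw [gaussianPDF]
      refine ENNReal.ofReal_le_ofReal ?_
      rw [mul_assoc (gaussianPDFReal 0 1 v), ← exp_add]
      simp only [gaussianPDFReal]
      rw [mul_assoc (√(2 * π * (1 : NNReal)))⁻¹, ← exp_add]
      refine mul_le_mul_of_nonneg_left (exp_le_exp.2 ?_) (by positivity)
      simp
      nlinarith [sq_nonneg (z - v)]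
    · exact (integrableOn_exp_mul_Ioi (by linarith) _).const_mul _
    · exact Eventually.of_forall fun z => mul_nonneg
        (mul_nonneg (gaussianPDFReal_nonneg _ _ _) (exp_pos _).le) (exp_pos _).le
  rw [← ofReal_stdNormalTail] at h2
  exact (ENNReal.ofReal_le_ofReal_iff (div_nonneg (gaussianPDFReal_nonneg _ _ _) hv.le)).1 h2

/-- Joint exceedance probability of two correlated standard normal variables. -/
lemma IsGaussFam.measure_pair_le {Ω ι : Type*} [MeasurableSpace Ω] [Fintype ι] {μ : Measure Ω}
    [IsProbabilityMeasure μ] {X : ι → Ω → ℝ} {r : ι → ι → ℝ} (h : IsGaussFam μ X 0 r)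
    {i j : ι} (hi : r i i = 1) (hj : r j j = 1) (hij : r i j = r j i)
    (h0 : 0 ≤ r i j) {v : ℝ} (hv : 0 ≤ v) :
    μ.real {ω | v < X i ω ∧ v < X j ω} ≤ exp (-(v ^ 2 * (1 - r i j) / 4)) * stdNormalTail v := by
  classical
  have hpair := h.affine (κ := Fin 2) ![Pi.single i 1, Pi.single j 1] 0
  have hle := hpair.quadForm_nonneg ![1, -1]
  have hmap := hpair.map_sum ![1, 1]
  simp [Fin.sum_univ_two, Pi.single_apply, hi, hj, ← hij] at hle hmap
  have hr1 : r i j ≤ 1 := by linarith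
  have hm : Measurable fun ω => X i ω + X j ω := (h.meas i).add (h.meas j)
  set R := r i j
  have hpos : 0 < 2 * (1 + R) := by linarith
  have h1 : μ {ω | v < X i ω ∧ v < X j ω} ≤ gaussianReal 0 1 (Ioi (v * √(2 / (1 + R)))) := by
    calc μ {ω | v < X i ω ∧ v < X j ω} ≤ μ {ω | 2 * v < X i ω + X j ω} :=
          measure_mono fun ω hω => by
            have h1 : v < X i ω := hω.1
            have h2 : v < X j ω := hω.2
            show 2 * v < X i ω + X j ω
            linarith
      _ = μ.map (fun ω => X i ω + X j ω) (Ioi (2 * v)) := by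
          rw [Measure.map_apply hm measurableSet_Ioi]; rfl
      _ = gaussianReal 0 1 (Ioi (2 * v / √(2 * (1 + R)))) := by
          rw [hmap]
          refine gaussianReal_Ioi (sqrt_pos.2 hpos) ?_ _
          rw [sq_sqrt hpos.le, Real.coe_toNNReal _ (by linarith)]
          ring
      _ = _ := by
          congr 2
          rw [mul_comm, mul_div_assoc]
          congr 1
          rw [div_eq_iff (sqrt_pos.2 hpos).ne', ← sqrt_mul (by positivity)]
          rw [show 2 / (1 + R) * (2 * (1 + R)) = 2 ^ 2 by field_simp]
          simp
  have h2 : μ.real {ω | v < X i ω ∧ v < X j ω} ≤ stdNormalTail (v * √(2 / (1 + R))) :=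
    ENNReal.toReal_mono (measure_ne_top _ _) h1
  have hs : 1 ≤ 2 / (1 + R) := by rw [le_div_iff₀ (by linarith)]; linarith
  refine h2.trans ((stdNormalTail_mul_le hv (by rwa [one_le_sqrt])).trans ?_)
  refine mul_le_mul_of_nonneg_right (exp_le_exp.2 ?_) (stdNormalTail_pos _).le
  rw [sq_sqrt (by linarith)]
  have : (1 - R) / 2 ≤ 2 / (1 + R) - 1 := by
    rw [le_sub_iff_add_le, le_div_iff₀ (by linarith)]
    nlinarith
  nlinarith [mul_le_mul_of_nonneg_left this (sq_nonneg v)]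

lemma isGaussFam_gaussianReal {ι : Type*} [Fintype ι] (a : ι → ℝ) :
    IsGaussFam (gaussianReal 0 1) (fun i z => a i * z) 0 (fun i j => a i * a j) where
  meas i := by fun_prop
  charFun c := by
    have h := charFun_gaussianReal (μ := 0) (v := 1) (t := ∑ i, c i * a i)
    rw [charFun_apply_real] at h
    have h1 : ∀ z : ℝ, ∑ i, c i * (a i * z) = (∑ i, c i * a i) * z := fun z => by
      simp only [Finset.sum_mul, mul_assoc]
    have h2 : ∑ i, ∑ j, c i * c j * (a i * a j) = (∑ i, c i * a i) ^ 2 := by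
      rw [sq, Finset.sum_mul_sum]
      exact Finset.sum_congr rfl fun i _ => Finset.sum_congr rfl fun j _ => by ring
    simp only [h1, h2]
    simpa using h

/-- Residuals of a Gaussian family after regression on the member `i₀`. -/
lemma IsGaussFam.residual {Ω ι : Type*} [MeasurableSpace Ω] [Fintype ι] {μ : Measure Ω}
    {X : ι → Ω → ℝ} {r : ι → ι → ℝ} (h : IsGaussFam μ X 0 r) {i₀ : ι} (hd : r i₀ i₀ = 1)
    (hs : ∀ i j, r i j = r j i) (a : ℝ) (b : ι → ℝ) :
    IsGaussFam μ (fun i ω => a * (X i ω - r i i₀ * X i₀ ω) + b i) b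
      (fun i j => a ^ 2 * (r i j - r i i₀ * r j i₀)) := by
  classical
  obtain ⟨A, hA⟩ : ∃ A : ι → ι → ℝ, ∀ (f : ι → ℝ) i, ∑ j, A i j * f j
      = a * (f i - r i i₀ * f i₀) := by
    refine ⟨fun i j => a * ((Pi.single i 1 : ι → ℝ) j - r i i₀ * (Pi.single i₀ 1 : ι → ℝ) j),
      fun f i => ?_⟩
    simp only [mul_assoc, ← Finset.mul_sum, sub_mul, Finset.sum_sub_distrib]
    simp [Pi.single_apply]
  have h1 := h.affine A b
  simp only [mul_assoc, ← Finset.mul_sum, hA] at h1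
  refine h1.congr (fun i => by simp) (fun i j => ?_)
  rw [hs i₀ j, hd]
  ring

lemma lintegral_eq_lintegral_sub_div (f : ℝ → ENNReal) (hf : Measurable f) {v : ℝ} (hv : 0 < v) :
    ∫⁻ z, f z = ENNReal.ofReal (1 / v) * ∫⁻ y, f (v - y / v) := by
  have h1 := Real.map_volume_mul_left (a := v⁻¹) (inv_ne_zero hv.ne')
  have h2 : ∫⁻ y, f (v - y / v) = ENNReal.ofReal v * ∫⁻ y, f (v - y) := by
    have h3 : ∫⁻ y, f (v - y / v) = ∫⁻ y, f (v - y) ∂(Measure.map (v⁻¹ * ·) volume) := by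
      rw [lintegral_map (by fun_prop) (by fun_prop)]
      simp only [div_eq_inv_mul]
    rw [h3, h1, lintegral_smul_measure, inv_inv, abs_of_pos hv, smul_eq_mul]
  rw [h2, lintegral_sub_left_eq_self f v, ← mul_assoc, ← ENNReal.ofReal_mul (by positivity)]
  simp [hv.ne']

lemma lintegral_exp_ciSup {Ω ι : Type*} [MeasurableSpace Ω] [Fintype ι] [Nonempty ι] {μ : Measure Ω}
    [SFinite μ] {W : ι → Ω → ℝ} (hW : ∀ i, Measurable (W i)) :
    ∫⁻ ω, ENNReal.ofReal (exp (⨆ i, W i ω)) ∂μ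
      = ∫⁻ y, ENNReal.ofReal (exp y) * μ {ω | ∃ i, y < W i ω} := by
  have hM : Measurable fun ω => ⨆ i, W i ω := Measurable.iSup hW
  have hset : MeasurableSet {p : ℝ × Ω | p.1 < ⨆ i, W i p.2} :=
    measurableSet_lt measurable_fst (hM.comp measurable_snd)
  have h1 : ∀ y : ℝ, {ω | ∃ i, y < W i ω} = {ω | y < ⨆ i, W i ω} := by
    intro y
    ext ω
    exact (lt_ciSup_iff (Set.finite_range _).bddAbove).symm
  have h2 : ∀ x : ℝ, ENNReal.ofReal (exp x) = ∫⁻ y, (Iio x).indicator (fun y => ENNReal.ofReal (exp y)) y := by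
    intro x
    rw [lintegral_indicator measurableSet_Iio, ← ofReal_integral_eq_lintegral_ofReal,
      ← integral_Iic_eq_integral_Iio, integral_exp_Iic]
    · exact (integrableOn_exp_Iic x).mono_set Iio_subset_Iic_self
    · exact Eventually.of_forall fun y => (exp_pos _).le
  calc _ = ∫⁻ ω, ∫⁻ y, {p : ℝ × Ω | p.1 < ⨆ i, W i p.2}.indicator
          (fun p => ENNReal.ofReal (exp p.1)) (y, ω) ∂volume ∂μ := by
        refine lintegral_congr fun ω => ?_
        rw [h2]
        rfl
    _ = ∫⁻ y, ∫⁻ ω, {p : ℝ × Ω | p.1 < ⨆ i, W i p.2}.indicator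
          (fun p => ENNReal.ofReal (exp p.1)) (y, ω) ∂μ := by
        rw [lintegral_lintegral_swap]
        exact ((Measurable.indicator (by fun_prop) hset).comp measurable_swap).aemeasurable
    _ = _ := by
        refine lintegral_congr fun y => ?_
        rw [h1]
        have : ∀ ω, {p : ℝ × Ω | p.1 < ⨆ i, W i p.2}.indicator
          (fun p => ENNReal.ofReal (exp p.1)) (y, ω) =
            {ω | y < ⨆ i, W i ω}.indicator (fun _ => ENNReal.ofReal (exp y)) ω := fun ω => rfl
        simp only [this]
        rw [lintegral_indicator (measurableSet_lt measurable_const hM)]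
        simp

/-- Conditioning on one member of a Gaussian family with unit variances. -/
lemma IsGaussFam.measure_exists_lt {Ω ι : Type*} [MeasurableSpace Ω] [Fintype ι] {μ : Measure Ω}
    [IsProbabilityMeasure μ] {X : ι → Ω → ℝ} {r : ι → ι → ℝ} (h : IsGaussFam μ X 0 r)
    (hd : ∀ i, r i i = 1) (hs : ∀ i j, r i j = r j i) (i₀ : ι) {v : ℝ} (hv : 0 < v) :
    ENNReal.ofReal (v / gaussianPDFReal 0 1 v) * μ {ω | ∃ i, v < X i ω} =
      ∫⁻ y, ENNReal.ofReal (exp (y - y ^ 2 / (2 * v ^ 2))) *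
        μ {ω | ∃ i, y < v * (X i ω - r i i₀ * X i₀ ω) +
          (-(v ^ 2 * (1 - r i i₀)) + (1 - r i i₀) * y)} := by
  have hU : ∀ i, Measurable fun ω => X i ω - r i i₀ * X i₀ ω := fun i => by
    have := h.meas
    fun_prop
  have h1 := (isGaussFam_gaussianReal fun i => r i i₀).prod_add (h.residual (hd i₀) hs 1 0)
  have h2 : μ {ω | ∃ i, v < X i ω} = ((gaussianReal 0 1).prod μ)
      {p | ∃ i, v < r i i₀ * p.1 + (X i p.2 - r i i₀ * X i₀ p.2)} := by
    have hS : MeasurableSet {x : ι → ℝ | ∃ i, v < x i} := by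
      simp only [ofPred_exists]
      exact MeasurableSet.iUnion fun i => measurableSet_lt measurable_const (measurable_pi_apply i)
    have := (h1.congr (fun i => by simp) (fun i j => by ring)).measure_eq h hS
    simpa using this.symm
  have hset : MeasurableSet {p : ℝ × Ω | ∃ i, v < r i i₀ * p.1 + (X i p.2 - r i i₀ * X i₀ p.2)} := by
    simp only [ofPred_exists]
    exact MeasurableSet.iUnion fun i => measurableSet_lt measurable_const
      ((measurable_fst.const_mul _).add ((hU i).comp measurable_snd))
  have hφ : 0 < gaussianPDFReal 0 1 v := gaussianPDFReal_pos _ _ _ one_ne_zero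
  rw [h2, Measure.prod_apply hset, gaussianReal_of_var_ne_zero _ one_ne_zero,
    lintegral_withDensity_eq_lintegral_mul _ (measurable_gaussianPDF _ _)
      (measurable_measure_prodMk_left hset),
    lintegral_eq_lintegral_sub_div _ ((measurable_gaussianPDF _ _).mul
      (measurable_measure_prodMk_left hset)) hv, ← mul_assoc,
    ← ENNReal.ofReal_mul (by positivity), ← lintegral_const_mul]
  · refine lintegral_congr fun y => ?_
    simp only [Pi.mul_apply, gaussianPDF]
    rw [← mul_assoc, ← ENNReal.ofReal_mul (by positivity)]
    congr 2
    · rw [div_mul_div_comm, mul_one, mul_comm (gaussianPDFReal 0 1 v), ← div_div,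
        div_self hv.ne', one_div_mul_eq_div, div_eq_iff hφ.ne']
      simp only [gaussianPDFReal]
      rw [mul_left_comm, ← exp_add]
      congr 2
      simp
      field_simp
      ring
    · ext ω
      simp only [mem_preimage, mem_ofPred_eq]
      refine exists_congr fun i => ?_
      rw [← mul_lt_mul_iff_right₀ hv]
      have e1 : v * (r i i₀ * (v - y / v) + (X i ω - r i i₀ * X i₀ ω)) =
        v ^ 2 * r i i₀ - r i i₀ * y + v * (X i ω - r i i₀ * X i₀ ω) := by
        field_simp
      rw [e1]
      constructor <;> intro h <;> nlinarith
  · exact ((measurable_gaussianPDF _ _).mul (measurable_measure_prodMk_left hset)).comp (by fun_prop)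

/-- Exceedance probabilities of locally stationary Gaussian families at high levels are bounded
below by the exponential moment of the maximum of the limiting field. -/
lemma IsGaussFam.le_liminf_exceed {Ω Ω' ι : Type*} [MeasurableSpace Ω] [MeasurableSpace Ω']
    [Fintype ι] {μ : Measure Ω} [IsProbabilityMeasure μ] {μ' : Measure Ω'} [IsProbabilityMeasure μ']
    {X : ℕ → ι → Ω → ℝ} {r : ℕ → ι → ι → ℝ} {v : ℕ → ℝ} (h : ∀ n, IsGaussFam μ (X n) 0 (r n))
    (hd : ∀ n i, r n i i = 1) (hs : ∀ n i j, r n i j = r n j i) (hv : ∀ n, 0 < v n)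
    (hvt : Tendsto v atTop atTop) {D : ι → ι → ℝ}
    (hD : ∀ i j, Tendsto (fun n => v n ^ 2 * (1 - r n i j)) atTop (nhds (D i j)))
    (i₀ : ι) {W : ι → Ω' → ℝ} (hW : IsGaussFam μ' W (fun i => -D i i₀)
      (fun i j => D i i₀ + D j i₀ - D i j)) :
    ∫⁻ ω, ENNReal.ofReal (exp (⨆ i, W i ω)) ∂μ' ≤
      liminf (fun n => ENNReal.ofReal (v n / gaussianPDFReal 0 1 (v n)) *
        μ {ω | ∃ i, v n < X n i ω}) atTop := by
  have : Nonempty ι := ⟨i₀⟩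
  have hinv : Tendsto (fun n => (v n ^ 2)⁻¹) atTop (nhds 0) :=
    ((tendsto_pow_atTop two_ne_zero).comp hvt).inv_tendsto_atTop
  have hr : ∀ i j, Tendsto (fun n => 1 - r n i j) atTop (nhds 0) := by
    intro i j
    have := hinv.mul (hD i j)
    rw [zero_mul] at this
    refine this.congr fun n => ?_
    have := (hv n).ne'
    field_simp
  rw [lintegral_exp_ciSup hW.meas]
  simp only [fun n => (h n).measure_exists_lt (hd n) (hs n) i₀ (hv n)]
  refine (lintegral_mono fun y => ?_).trans (lintegral_liminf_le fun n => ?_)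
  · have hS : IsOpen {x : ι → ℝ | ∃ i, y < x i} := by
      simp only [ofPred_exists]
      exact isOpen_iUnion fun i => isOpen_lt continuous_const (continuous_apply i)
    have h1 := IsGaussFam.le_liminf_measure
      (fun n => (h n).residual (hd n i₀) (hs n) (v n)
        (fun i => -(v n ^ 2 * (1 - r n i i₀)) + (1 - r n i i₀) * y)) hW
      (fun i => by simpa using (hD i i₀).neg.add ((hr i i₀).mul_const y))
      (fun i j => by
        have := (((hD i i₀).add (hD j i₀)).sub (hD i j)).sub ((hD i i₀).mul (hr j i₀))
        rw [mul_zero, sub_zero] at this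
        refine this.congr fun n => ?_
        ring) hS
    have h2 : Tendsto (fun n => ENNReal.ofReal (exp (y - y ^ 2 / (2 * v n ^ 2)))) atTop
        (nhds (ENNReal.ofReal (exp y))) := by
      refine (ENNReal.continuous_ofReal.tendsto _).comp ((continuous_exp.tendsto _).comp ?_)
      have := (hinv.const_mul (y ^ 2 / 2)).const_sub y
      rw [mul_zero, sub_zero] at this
      refine this.congr fun n => ?_
      have := (hv n).ne'
      field_simp
    calc _ ≤ liminf (fun n => ENNReal.ofReal (exp (y - y ^ 2 / (2 * v n ^ 2)))) atTop * _ :=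
          mul_le_mul' h2.liminf_eq.ge h1
      _ ≤ _ := ENNReal.le_liminf_mul
  · have := (h n).meas
    refine Measurable.mul (by fun_prop) ?_
    have hset : MeasurableSet {p : ℝ × Ω | ∃ i, p.1 < v n * (X n i p.2 - r n i i₀ * X n i₀ p.2) +
          (-(v n ^ 2 * (1 - r n i i₀)) + (1 - r n i i₀) * p.1)} := by
      simp only [ofPred_exists]
      exact MeasurableSet.iUnion fun i => measurableSet_lt measurable_fst (by fun_prop)
    exact measurable_measure_prodMk_left hset

/-- Quantitative form of `IsGaussFam.le_liminf_exceed`, uniform over the Gaussian family. -/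
lemma exists_exceed_lower_bound {Ω Ω' ι : Type*} [MeasurableSpace Ω] [MeasurableSpace Ω']
    [Fintype ι] (μ : Measure Ω) [IsProbabilityMeasure μ] {μ' : Measure Ω'} [IsProbabilityMeasure μ']
    {D : ι → ι → ℝ} (i₀ : ι) {W : ι → Ω' → ℝ} (hW : IsGaussFam μ' W (fun i => -D i i₀)
      (fun i j => D i i₀ + D j i₀ - D i j)) {K : ℝ} (hK0 : 0 ≤ K)
    (hK : ENNReal.ofReal K < ∫⁻ ω, ENNReal.ofReal (exp (⨆ i, W i ω)) ∂μ') :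
    ∃ κ > 0, ∃ V : ℝ, ∀ v ≥ V, ∀ (X : ι → Ω → ℝ) (r : ι → ι → ℝ), IsGaussFam μ X 0 r →
      (∀ i, r i i = 1) → (∀ i j, r i j = r j i) → (∀ i j, |v ^ 2 * (1 - r i j) - D i j| ≤ κ) →
      K * stdNormalTail v ≤ μ.real {ω | ∃ i, v < X i ω} := by
  by_contra! hcon
  choose v hv X r h hd hs hD hlt using fun n : ℕ =>
    hcon (1 / ((n : ℝ) + 1)) (by positivity) ((n : ℝ) + 1)
  have hv0 : ∀ n, 0 < v n := fun n => lt_of_lt_of_le (by positivity) (hv n)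
  have hvt : Tendsto v atTop atTop :=
    tendsto_atTop_mono hv (tendsto_natCast_atTop_atTop.atTop_add tendsto_const_nhds)
  have hDt : ∀ i j, Tendsto (fun n => v n ^ 2 * (1 - r n i j)) atTop (nhds (D i j)) := by
    intro i j
    rw [tendsto_iff_dist_tendsto_zero]
    exact squeeze_zero (fun n => dist_nonneg) (fun n => hD n i j)
      tendsto_one_div_add_atTop_nhds_zero_nat
  have h1 := hK.trans_le (IsGaussFam.le_liminf_exceed h hd hs hv0 hvt hDt i₀ hW)
  obtain ⟨n, hn⟩ := (eventually_lt_of_lt_liminf h1).exists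
  have hφ : 0 < gaussianPDFReal 0 1 (v n) := gaussianPDFReal_pos _ _ _ one_ne_zero
  rw [← ofReal_measureReal, ← ENNReal.ofReal_mul (div_nonneg (hv0 n).le hφ.le)] at hn
  have h2 := (ENNReal.ofReal_lt_ofReal_iff_of_nonneg hK0).1 hn
  have h3 := mul_le_mul_of_nonneg_left (stdNormalTail_le_pdf_div (hv0 n)) hK0
  have h4 : K * (gaussianPDFReal 0 1 (v n) / v n) ≤ μ.real {ω | ∃ i, v n < X n i ω} := by
    rw [← mul_div_assoc, div_le_iff₀ (hv0 n)]
    rw [div_mul_eq_mul_div, lt_div_iff₀ hφ] at h2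
    linarith
  exact absurd (hlt n) (not_lt.2 (h3.trans h4))

lemma exists_exp_neg_le_rpow (p : ℝ) (hp : 0 ≤ p) : ∃ C > 0, ∀ x > 0, exp (-x) ≤ C * x ^ (-p) := by
  refine ⟨(⌈p⌉₊.factorial : ℝ), by positivity, fun x hx => ?_⟩
  have hfac : (1 : ℝ) ≤ (⌈p⌉₊.factorial : ℝ) := by exact_mod_cast Nat.factorial_pos _
  rw [exp_neg, rpow_neg hx.le, inv_le_comm₀ (exp_pos _) (by positivity), mul_inv, inv_inv,
    inv_mul_le_iff₀ (by positivity)]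
  rcases le_total 1 x with h1 | h1
  · calc x ^ p ≤ x ^ (⌈p⌉₊ : ℝ) := rpow_le_rpow_of_exponent_le h1 (Nat.le_ceil p)
      _ = x ^ ⌈p⌉₊ := rpow_natCast _ _
      _ ≤ _ := by
        have := pow_div_factorial_le_exp x hx.le ⌈p⌉₊
        rwa [div_le_iff₀' (by positivity)] at this
  · calc x ^ p ≤ 1 := rpow_le_one hx.le h1 hp
      _ ≤ exp x := one_le_exp hx.le
      _ ≤ _ := le_mul_of_one_le_left (exp_pos _).le hfac

lemma IsGaussFam.mul_add {Ω ι : Type*} [MeasurableSpace Ω] [Fintype ι] {μ : Measure Ω}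
    {X : ι → Ω → ℝ} {m : ι → ℝ} {C : ι → ι → ℝ} (h : IsGaussFam μ X m C) (a b : ι → ℝ) :
    IsGaussFam μ (fun i ω => a i * X i ω + b i) (fun i => a i * m i + b i)
      (fun i j => a i * a j * C i j) := by
  classical
  have h1 := h.affine (fun i j => if i = j then a i else 0) b
  simpa [mul_assoc, ← Finset.mul_sum] using h1

/-- Exponential moment of the maximum of `√2 B(t) - t ^ (2H)` over the grid `0, a, …, m a`. -/
noncomputable def gridExpMax {Ω : Type*} [MeasurableSpace Ω] (μ : Measure Ω) (H : ℝ)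
    (B : ℝ → Ω → ℝ) (a : ℝ) (m : ℕ) : ENNReal :=
  ∫⁻ ω, ENNReal.ofReal (exp (⨆ i : Fin (m + 1), (√2 * B (a * (i : ℕ)) ω - (a * (i : ℕ)) ^ (2*H)))) ∂μ

section Fbm

variable {Ω : Type*} [MeasurableSpace Ω] {μ : Measure Ω} {H : ℝ} {B : ℝ → Ω → ℝ}

lemma isGaussFam_drift (hB : IsFbm μ H B) {ι : Type*} [Fintype ι] (t : ι → ℝ) (ht : ∀ i, 0 ≤ t i) :
    IsGaussFam μ (fun i ω => √2 * B (t i) ω - t i ^ (2*H)) (fun i => -t i ^ (2*H))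
      (fun i j => t i ^ (2*H) + t j ^ (2*H) - |t i - t j| ^ (2*H)) := by
  refine ((isGaussFam_fbm hB t ht).mul_add (fun _ => √2)
    (fun i => -t i ^ (2*H))).congr (fun i => by simp) (fun i j => ?_)
  rw [mul_self_sqrt (by norm_num)]
  ring

lemma lintegral_exp_drift [IsProbabilityMeasure μ] (hB : IsFbm μ H B) (hH : 0 < H)
    {s t : ℝ} (hs : 0 ≤ s) (ht : 0 ≤ t) (θ : ℝ) :
    ∫⁻ ω, ENNReal.ofReal (exp ((√2 * B t ω - t ^ (2*H)) + θ * ((√2 * B t ω - t ^ (2*H)) -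
      (√2 * B s ω - s ^ (2*H))))) ∂μ = ENNReal.ofReal (exp ((θ + θ ^ 2) * |t - s| ^ (2*H))) := by
  have h := (isGaussFam_drift hB ![t, s]
    (fun i => by fin_cases i <;> simpa)).lintegral_exp ![1 + θ, -θ]
  simp [Fin.sum_univ_two, abs_sub_comm s t, zero_rpow (by positivity : 2 * H ≠ 0)] at h
  convert h using 3
  · congr 2
    ring
  · ring

lemma gridExpMax_le [IsProbabilityMeasure μ] (hB : IsFbm μ H B) (hH : 0 < H)
    {a : ℝ} (ha : 0 ≤ a) (m : ℕ) : gridExpMax μ H B a m ≤ m + 1 := by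
  calc gridExpMax μ H B a m ≤ ∫⁻ ω, ∑ i : Fin (m + 1),
        ENNReal.ofReal (exp (√2 * B (a * (i : ℕ)) ω - (a * (i : ℕ)) ^ (2*H))) ∂μ := by
        refine lintegral_mono fun ω => ?_
        obtain ⟨i, hi⟩ := exists_eq_ciSup_of_finite (f := fun i : Fin (m + 1) =>
          √2 * B (a * (i : ℕ)) ω - (a * (i : ℕ)) ^ (2*H))
        simp only [← hi]
        exact Finset.single_le_sum (f := fun i : Fin (m + 1) =>
          ENNReal.ofReal (exp (√2 * B (a * (i : ℕ)) ω - (a * (i : ℕ)) ^ (2*H))))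
          (fun _ _ => zero_le) (Finset.mem_univ i)
    _ = ∑ i : Fin (m + 1), ∫⁻ ω,
        ENNReal.ofReal (exp (√2 * B (a * (i : ℕ)) ω - (a * (i : ℕ)) ^ (2*H))) ∂μ := by
        have := hB.meas
        refine lintegral_finsetSum _ fun i _ => ?_
        fun_prop
    _ = m + 1 := by
        have : ∀ i : Fin (m + 1), ∫⁻ ω,
            ENNReal.ofReal (exp (√2 * B (a * (i : ℕ)) ω - (a * (i : ℕ)) ^ (2*H))) ∂μ = 1 := by
          intro i
          have h0 : 0 ≤ a * (i : ℕ) := by positivity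
          simpa using lintegral_exp_drift hB hH h0 h0 0
        simp [this]

lemma exists_gridExpMax_half_le [IsProbabilityMeasure μ] (hB : IsFbm μ H B)
    (hH : 0 < H) : ∃ K > 0, ∀ a, 0 < a → a ≤ 1 → ∀ m : ℕ,
    gridExpMax μ H B (a / 2) (2 * m) ≤ ENNReal.ofReal (exp (a ^ (H / 2))) * gridExpMax μ H B a m
      + ENNReal.ofReal (K * (m * a ^ 2)) := by
  obtain ⟨C, hC, hexp⟩ := exists_exp_neg_le_rpow (4 / H) (by positivity)
  refine ⟨exp 2 * C, by positivity, fun a ha ha1 m => ?_⟩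
  set W : ℝ → Ω → ℝ := fun t ω => √2 * B t ω - t ^ (2*H) with hWdef
  have hWm : ∀ t, Measurable (W t) := fun t => ((hB.meas t).const_mul _).sub_const _
  set η : ℝ := a ^ (H / 2) with hη
  have hη0 : 0 < η := by positivity
  set θ : ℝ := (a / 2) ^ (-H) with hθ
  have hθ0 : 0 < θ := by positivity
  have hpt : ∀ ω, ENNReal.ofReal (exp (⨆ i : Fin (2 * m + 1), W (a / 2 * (i : ℕ)) ω)) ≤
      ENNReal.ofReal (exp η) * ENNReal.ofReal (exp (⨆ i : Fin (m + 1), W (a * (i : ℕ)) ω)) +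
      ∑ j ∈ Finset.range m, ENNReal.ofReal (exp (-(θ * η))) *
        ENNReal.ofReal (exp (W (a / 2 * (2 * j + 1)) ω +
        θ * (W (a / 2 * (2 * j + 1)) ω - W (a * j) ω))) := by
    intro ω
    obtain ⟨i, hi⟩ := exists_eq_ciSup_of_finite (f := fun i : Fin (2 * m + 1) => W (a / 2 * (i : ℕ)) ω)
    have hcoarse : ∀ j : ℕ, j ≤ m → W (a * j) ω ≤ ⨆ i : Fin (m + 1), W (a * (i : ℕ)) ω := fun j hj =>
      le_ciSup (f := fun i : Fin (m + 1) => W (a * (i : ℕ)) ω) (Set.finite_range _).bddAbove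
        ⟨j, Nat.lt_succ_of_le hj⟩
    rw [← hi]
    rcases Nat.even_or_odd' (i : ℕ) with ⟨j, hj | hj⟩
    · refine le_add_right ?_
      rw [← ENNReal.ofReal_mul (exp_pos _).le, ← exp_add]
      refine ENNReal.ofReal_le_ofReal (exp_le_exp.2 ?_)
      have h1 : a / 2 * (i : ℕ) = a * j := by rw [hj]; push_cast; ring
      simp only [h1]
      linarith [hcoarse j (by omega)]
    · have h1 : a / 2 * (i : ℕ) = a / 2 * (2 * j + 1) := by rw [hj]; push_cast; ring
      have hjm : j < m := by omega
      simp only [h1]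
      rcases le_total (W (a / 2 * (2 * j + 1)) ω - W (a * j) ω) η with h2 | h2
      · refine le_add_right ?_
        rw [← ENNReal.ofReal_mul (exp_pos _).le, ← exp_add]
        refine ENNReal.ofReal_le_ofReal (exp_le_exp.2 ?_)
        linarith [hcoarse j hjm.le]
      · refine le_add_left (le_trans ?_ (Finset.single_le_sum
          (f := fun j : ℕ => ENNReal.ofReal (exp (-(θ * η))) *
        ENNReal.ofReal (exp (W (a / 2 * (2 * j + 1)) ω +
          θ * (W (a / 2 * (2 * j + 1)) ω - W (a * j) ω)))) (fun _ _ => zero_le)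
          (Finset.mem_range.2 hjm)))
        rw [← ENNReal.ofReal_mul (exp_pos _).le, ← exp_add]
        refine ENNReal.ofReal_le_ofReal (exp_le_exp.2 ?_)
        nlinarith [mul_le_mul_of_nonneg_left h2 hθ0.le]
  have hterm : ∀ j : ℕ, ∫⁻ ω, ENNReal.ofReal (exp (-(θ * η))) *
        ENNReal.ofReal (exp (W (a / 2 * (2 * j + 1)) ω +
        θ * (W (a / 2 * (2 * j + 1)) ω - W (a * j) ω))) ∂μ ≤ ENNReal.ofReal (exp 2 * C * a ^ 2) := by
    intro j
    rw [lintegral_const_mul _ (by fun_prop), lintegral_exp_drift hB hH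
      (by positivity) (by positivity), ← ENNReal.ofReal_mul (exp_pos _).le, ← exp_add]
    refine ENNReal.ofReal_le_ofReal ?_
    have h1 : |a / 2 * (2 * j + 1) - a * j| = a / 2 := by
      rw [show a / 2 * (2 * j + 1) - a * j = a / 2 by ring, abs_of_pos (by positivity)]
    have h2 : θ ^ 2 * (a / 2) ^ (2 * H) = 1 := by
      rw [hθ, ← rpow_natCast, ← rpow_mul (by positivity), ← rpow_add (by positivity)]
      norm_num
      ring_nf
      simp
    have h3 : θ * (a / 2) ^ (2 * H) ≤ 1 := by
      rw [hθ, ← rpow_add (by positivity)]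
      exact rpow_le_one (by positivity) (by linarith) (by linarith)
    have h4 : a ^ (-(H / 2)) ≤ θ * η := by
      have : a ^ (-H) ≤ θ := rpow_le_rpow_of_nonpos (by positivity) (by linarith) (by linarith)
      calc a ^ (-(H / 2)) = a ^ (-H) * η := by
            rw [hη, ← rpow_add ha]; ring_nf
        _ ≤ θ * η := by gcongr
    have h5 : exp (-(θ * η)) ≤ C * a ^ 2 := by
      calc exp (-(θ * η)) ≤ exp (-(a ^ (-(H / 2)))) := exp_le_exp.2 (by linarith)
        _ ≤ C * (a ^ (-(H / 2))) ^ (-(4 / H)) := hexp _ (by positivity)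
        _ = C * a ^ 2 := by
          rw [← rpow_mul ha.le, ← rpow_natCast]
          congr 2
          field_simp
          norm_num
    rw [h1, add_mul, h2, exp_add, mul_comm (exp (-(θ * η))), mul_assoc]
    refine mul_le_mul (exp_le_exp.2 (by linarith)) h5 (exp_pos _).le (exp_pos _).le
  calc gridExpMax μ H B (a / 2) (2 * m) ≤
      ∫⁻ ω, (ENNReal.ofReal (exp η) * ENNReal.ofReal (exp (⨆ i : Fin (m + 1), W (a * (i : ℕ)) ω)) +
      ∑ j ∈ Finset.range m, ENNReal.ofReal (exp (-(θ * η))) *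
        ENNReal.ofReal (exp (W (a / 2 * (2 * j + 1)) ω +
        θ * (W (a / 2 * (2 * j + 1)) ω - W (a * j) ω)))) ∂μ := lintegral_mono hpt
    _ = ENNReal.ofReal (exp η) * gridExpMax μ H B a m + ∑ j ∈ Finset.range m,
        ∫⁻ ω, ENNReal.ofReal (exp (-(θ * η))) *
        ENNReal.ofReal (exp (W (a / 2 * (2 * j + 1)) ω +
        θ * (W (a / 2 * (2 * j + 1)) ω - W (a * j) ω))) ∂μ := by
        have hsup : Measurable fun ω => ⨆ i : Fin (m + 1), W (a * (i : ℕ)) ω :=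
          Measurable.iSup fun i => hWm _
        rw [lintegral_add_left (by fun_prop), lintegral_const_mul _ (by fun_prop),
          lintegral_finsetSum _ (fun j _ => by fun_prop)]
        rfl
    _ ≤ _ := by
        refine add_le_add le_rfl ((Finset.sum_le_sum fun j _ => hterm j).trans ?_)
        rw [Finset.sum_const, Finset.card_range, ← ENNReal.ofReal_nsmul]
        refine ENNReal.ofReal_le_ofReal (le_of_eq ?_)
        simp
        ring

end Fbm

section Fbm

variable {Ω : Type*} [MeasurableSpace Ω] {μ : Measure Ω} {H : ℝ} {B : ℝ → Ω → ℝ}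

/-- Suprema of a continuous function over finer and finer grids. -/
lemma ofReal_exp_ciSup_le_liminf {f : ℝ → ℝ} (hf : ContinuousOn f (Ici 0)) {a : ℝ} (ha : 0 < a) (m : ℕ) :
    ENNReal.ofReal (exp (⨆ t : Icc (0 : ℝ) (m * a), f t)) ≤ liminf (fun n : ℕ => ENNReal.ofReal
      (exp (⨆ i : Fin (2 ^ n * m + 1), f (a / 2 ^ n * (i : ℕ))))) atTop := by
  have hne : (Icc (0 : ℝ) (m * a)).Nonempty := nonempty_Icc.2 (by positivity)
  obtain ⟨t, ht, hmax⟩ := isCompact_Icc.exists_isMaxOn hne (hf.mono Icc_subset_Ici_self)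
  have h1 : (⨆ t : Icc (0 : ℝ) (m * a), f t) = f t := by
    have : Nonempty (Icc (0 : ℝ) (m * a)) := hne.to_subtype
    refine le_antisymm (ciSup_le fun s => hmax s.2) (le_ciSup (f := fun s : Icc (0 : ℝ) (m * a) => f s)
      ⟨f t, ?_⟩ ⟨t, ht⟩)
    rintro _ ⟨s, rfl⟩
    exact hmax s.2
  have hpow : Tendsto (fun n : ℕ => (2 : ℝ) ^ n / a) atTop atTop :=
    (tendsto_pow_atTop_atTop_of_one_lt one_lt_two).atTop_div_const ha
  have h2 : Tendsto (fun n : ℕ => a / 2 ^ n * (⌊t * (2 ^ n / a)⌋₊ : ℝ)) atTop (nhds t) := by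
    have := (tendsto_nat_floor_mul_div_atTop ht.1).comp hpow
    refine this.congr fun n => ?_
    simp only [Function.comp_def]
    field_simp
  have h3 : Tendsto (fun n : ℕ => ENNReal.ofReal (exp (f (a / 2 ^ n * (⌊t * (2 ^ n / a)⌋₊ : ℝ))))) atTop
      (nhds (ENNReal.ofReal (exp (f t)))) := by
    refine (ENNReal.continuous_ofReal.tendsto _).comp ((continuous_exp.tendsto _).comp ?_)
    refine (hf t ht.1).tendsto.comp (tendsto_nhdsWithin_iff.2 ⟨h2, Eventually.of_forall fun n => ?_⟩)
    exact mem_Ici.2 (by positivity)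
  rw [h1, ← h3.liminf_eq]
  refine liminf_le_liminf (Eventually.of_forall fun n => ENNReal.ofReal_le_ofReal (exp_le_exp.2 ?_))
  have hle : ⌊t * (2 ^ n / a)⌋₊ < 2 ^ n * m + 1 := by
    refine Nat.lt_succ_of_le ?_
    have : t * (2 ^ n / a) ≤ ((2 ^ n * m : ℕ) : ℝ) := by
      push_cast
      calc t * (2 ^ n / a) ≤ (m * a) * (2 ^ n / a) := by gcongr; exact ht.2
        _ = _ := by field_simp
    exact (Nat.floor_le_floor this).trans (Nat.floor_natCast _).le
  exact le_ciSup (f := fun i : Fin (2 ^ n * m + 1) => f (a / 2 ^ n * (i : ℕ)))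
    (Set.finite_range _).bddAbove ⟨_, hle⟩

/-- The exponential moment of the maximum over an interval is controlled by that over a grid. -/
lemma exists_integral_exp_sup_le [IsProbabilityMeasure μ] (hB : IsFbm μ H B) (hH : 0 < H) :
    ∃ K > 0, ∃ c > 0, ∀ a, 0 < a → a ≤ 1 → ∀ m : ℕ,
      ∫ ω, exp (⨆ t : Icc (0 : ℝ) (m * a), (√2 * B t ω - (t : ℝ) ^ (2*H))) ∂μ ≤
        exp (c * a ^ (H / 2)) * ((gridExpMax μ H B a m).toReal + K * (m * a ^ 2)) := by
  obtain ⟨K, hK, hhalf⟩ := exists_gridExpMax_half_le hB hH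
  set ρ : ℝ := 2⁻¹ ^ (H / 2) with hρ
  have hρ0 : 0 < ρ := by positivity
  have hρ1 : ρ < 1 := rpow_lt_one (by norm_num) (by norm_num) (by positivity)
  refine ⟨2 * K, by positivity, (1 - ρ)⁻¹, inv_pos.2 (by linarith), fun a ha ha1 m => ?_⟩
  have hind : ∀ n : ℕ, gridExpMax μ H B (a / 2 ^ n) (2 ^ n * m) ≤
      ENNReal.ofReal (exp ((∑ k ∈ Finset.range n, ρ ^ k) * a ^ (H / 2))) *
        (gridExpMax μ H B a m + ENNReal.ofReal (K * (m * a ^ 2) * ∑ k ∈ Finset.range n, 2⁻¹ ^ k)) := by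
    intro n
    induction n with
    | zero => simp
    | succ n ih =>
      have h1 := hhalf (a / 2 ^ n) (by positivity)
        ((div_le_self ha.le (one_le_pow₀ one_le_two)).trans ha1) (2 ^ n * m)
      have h2 : (a / 2 ^ n) ^ (H / 2) = ρ ^ n * a ^ (H / 2) := by
        rw [div_eq_mul_inv, mul_rpow ha.le (by positivity), mul_comm, hρ, ← inv_pow,
          ← rpow_natCast, ← rpow_mul (by norm_num), mul_comm (n : ℝ), rpow_mul (by norm_num),
          rpow_natCast]
      have h3 : K * (((2 ^ n * m : ℕ) : ℝ) * (a / 2 ^ n) ^ 2) = K * (m * a ^ 2) * 2⁻¹ ^ n := by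
        push_cast
        rw [inv_pow]
        field_simp
      rw [h2, h3] at h1
      have e1 : a / 2 ^ (n + 1) = a / 2 ^ n / 2 := by rw [pow_succ, div_div]
      have e2 : 2 ^ (n + 1) * m = 2 * (2 ^ n * m) := by ring
      rw [e1, e2]
      refine h1.trans ((add_le_add (mul_le_mul_right ih _) le_rfl).trans ?_)
      rw [← mul_assoc, ← ENNReal.ofReal_mul (exp_pos _).le, ← exp_add, Finset.sum_range_succ,
        Finset.sum_range_succ, add_mul, mul_add (K * (m * a ^ 2)),
        ENNReal.ofReal_add (by positivity) (by positivity), ← add_assoc,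
        mul_add _ _ (ENNReal.ofReal (K * (m * a ^ 2) * 2⁻¹ ^ n)),
        add_comm (ρ ^ n * a ^ (H / 2))]
      refine add_le_add le_rfl (le_mul_of_one_le_left zero_le ?_)
      rw [ENNReal.one_le_ofReal]
      exact one_le_exp (by positivity)
  have hbound : ∀ n : ℕ, gridExpMax μ H B (a / 2 ^ n) (2 ^ n * m) ≤
      ENNReal.ofReal (exp ((1 - ρ)⁻¹ * a ^ (H / 2))) *
        (gridExpMax μ H B a m + ENNReal.ofReal (2 * K * (m * a ^ 2))) := by
    intro n
    refine (hind n).trans (mul_le_mul' (ENNReal.ofReal_le_ofReal (exp_le_exp.2 ?_))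
      (add_le_add le_rfl (ENNReal.ofReal_le_ofReal ?_)))
    · gcongr
      exact sum_le_hasSum _ (fun _ _ => by positivity) (hasSum_geometric_of_lt_one hρ0.le hρ1)
    · rw [mul_comm, mul_assoc]
      gcongr
      refine (sum_le_hasSum _ (fun _ _ => by positivity)
        (hasSum_geometric_of_lt_one (by norm_num) (by norm_num))).trans (by norm_num)
  have hfin : gridExpMax μ H B a m ≠ ⊤ :=
    ne_top_of_le_ne_top (by simp) (gridExpMax_le hB hH ha.le m)
  have hlim : ∫⁻ ω, ENNReal.ofReal (exp (⨆ t : Icc (0 : ℝ) (m * a), (√2 * B t ω - (t : ℝ) ^ (2*H)))) ∂μ ≤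
      ENNReal.ofReal (exp ((1 - ρ)⁻¹ * a ^ (H / 2))) *
        (gridExpMax μ H B a m + ENNReal.ofReal (2 * K * (m * a ^ 2))) := by
    calc _ ≤ ∫⁻ ω, liminf (fun n : ℕ => ENNReal.ofReal (exp (⨆ i : Fin (2 ^ n * m + 1),
          (√2 * B (a / 2 ^ n * (i : ℕ)) ω - (a / 2 ^ n * (i : ℕ)) ^ (2*H))))) atTop ∂μ := by
          refine lintegral_mono_ae (hB.cont.mono fun ω hω => ?_)
          refine ofReal_exp_ciSup_le_liminf (f := fun t => √2 * B t ω - t ^ (2 * H)) ?_ ha m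
          refine ((hω.const_mul _).continuousOn).sub ?_
          exact (continuous_id.rpow_const fun _ => Or.inr (by positivity)).continuousOn
      _ ≤ liminf (fun n : ℕ => gridExpMax μ H B (a / 2 ^ n) (2 ^ n * m)) atTop := by
          refine lintegral_liminf_le fun n => ?_
          have : ∀ i : Fin (2 ^ n * m + 1), Measurable fun ω =>
            √2 * B (a / 2 ^ n * (i : ℕ)) ω - (a / 2 ^ n * (i : ℕ)) ^ (2*H) := fun i =>
              ((hB.meas _).const_mul _).sub_const _
          have := Measurable.iSup this
          fun_prop
      _ ≤ _ := liminf_le_of_frequently_le' (Frequently.of_forall hbound)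
  have hreal : exp ((1 - ρ)⁻¹ * a ^ (H / 2)) * ((gridExpMax μ H B a m).toReal + 2 * K * (m * a ^ 2))
      = (ENNReal.ofReal (exp ((1 - ρ)⁻¹ * a ^ (H / 2))) *
        (gridExpMax μ H B a m + ENNReal.ofReal (2 * K * (m * a ^ 2)))).toReal := by
    rw [ENNReal.toReal_mul, ENNReal.toReal_add hfin ENNReal.ofReal_ne_top,
      ENNReal.toReal_ofReal (exp_pos _).le, ENNReal.toReal_ofReal (by positivity)]
  by_cases hint : Integrable (fun ω => exp (⨆ t : Icc (0 : ℝ) (m * a), (√2 * B t ω - (t : ℝ) ^ (2*H)))) μ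
  · rw [hreal, ← ENNReal.ofReal_le_iff_le_toReal,
      ofReal_integral_eq_lintegral_ofReal hint (Eventually.of_forall fun _ => (exp_pos _).le)]
    · exact hlim
    · exact ENNReal.mul_ne_top ENNReal.ofReal_ne_top (ENNReal.add_ne_top.2 ⟨hfin, ENNReal.ofReal_ne_top⟩)
  · rw [integral_undef hint]
    positivity

end Fbm

/-- Bound for the joint exceedance probability of two grid points at distance `n`. -/
noncomputable def pairDecay (H a : ℝ) (n : ℤ) : ℝ := exp (-(|a * n| ^ (2 * H) / 8))

lemma pairDecay_pos (H a : ℝ) (n : ℤ) : 0 < pairDecay H a n := exp_pos _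

lemma summable_pairDecay {H a : ℝ} (hH : 0 < H) (ha : 0 < a) : Summable (pairDecay H a) := by
  obtain ⟨C, hC, hexp⟩ := exists_exp_neg_le_rpow (1 / H) (by positivity)
  have h1 : Summable fun n : ℤ => C * (8 ^ (1 / H) * a ^ (-2 : ℝ)) * |(n : ℝ)| ^ (-2 : ℝ) :=
    (summable_abs_int_rpow one_lt_two).mul_left _
  refine Summable.of_norm_bounded_eventually h1 ?_
  rw [eventually_cofinite]
  refine (finite_singleton (0 : ℤ)).subset fun n hn => ?_
  by_contra h0
  refine hn ?_
  have hn0 : 0 < |(n : ℝ)| := abs_pos.2 (by exact_mod_cast h0)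
  rw [norm_of_nonneg (pairDecay_pos _ _ _).le, pairDecay, abs_mul, abs_of_pos ha]
  refine (hexp _ (by positivity)).trans (le_of_eq ?_)
  rw [div_rpow (by positivity) (by norm_num), ← rpow_mul (by positivity),
    mul_rpow ha.le hn0.le, rpow_neg (by norm_num : (0:ℝ) ≤ 8)]
  have : 2 * H * -(1 / H) = -2 := by field_simp
  rw [this, div_inv_eq_mul]
  ring

/-- Sum of `pairDecay` outside a window. -/
noncomputable def pairDecayTail (H a : ℝ) (G : ℕ) : ℝ :=
  ∑' n : ℤ, if (G : ℤ) ≤ |n| then pairDecay H a n else 0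

lemma summable_pairDecayTail {H a : ℝ} (hH : 0 < H) (ha : 0 < a) (G : ℕ) :
    Summable fun n : ℤ => if (G : ℤ) ≤ |n| then pairDecay H a n else 0 := by
  refine Summable.of_nonneg_of_le (fun n => ?_) (fun n => ?_) (summable_pairDecay hH ha)
  · split_ifs
    exacts [(pairDecay_pos _ _ _).le, le_rfl]
  · split_ifs
    exacts [le_rfl, (pairDecay_pos _ _ _).le]

lemma tendsto_pairDecayTail {H a : ℝ} (hH : 0 < H) (ha : 0 < a) :
    Tendsto (pairDecayTail H a) atTop (nhds 0) := by
  have h := tendsto_tsum_of_dominated_convergence (𝓕 := atTop)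
    (f := fun G : ℕ => fun n : ℤ => if (G : ℤ) ≤ |n| then pairDecay H a n else 0) (g := fun _ => 0)
    (summable_pairDecay hH ha) (fun n => ?_) (Eventually.of_forall fun G n => ?_)
  · rw [tsum_zero] at h
    exact h
  · refine tendsto_const_nhds.congr' ?_
    filter_upwards [eventually_gt_atTop n.natAbs] with G hG
    rw [if_neg (by rw [Int.abs_eq_natAbs]; omega)]
  · split_ifs
    · rw [norm_of_nonneg (pairDecay_pos _ _ _).le]
    · simpa using (pairDecay_pos _ _ _).le

/-- A grid of mesh `a` and windows of length `m` separated by gaps of length `G` which recover the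
squared Pickands constant up to the factor `θ`. -/
lemma exists_grid_params {Ω : Type*} [MeasurableSpace Ω] {μ : Measure Ω} [IsProbabilityMeasure μ]
    {H : ℝ} {B : ℝ → Ω → ℝ} (hB : IsFbm μ H B) (hH : 0 < H) {HH : ℝ} (hHH : 0 < HH)
    (hPick : Tendsto (fun lam : ℝ => lam⁻¹ * ∫ ω, exp (⨆ t : Icc (0:ℝ) lam,
          (√2 * B (t:ℝ) ω - (t:ℝ) ^ (2*H))) ∂μ) atTop (nhds HH)) {θ : ℝ} (hθ1 : θ < 1) :
    ∃ a > 0, ∃ m G : ℕ, 0 < G ∧ ∃ K ≥ 0, ENNReal.ofReal K < gridExpMax μ H B a m ^ 2 ∧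
      θ * HH ^ 2 * (a * (m + G)) ^ 2 ≤
        K - (m + 1) ^ 2 * (2 * (∑' n, pairDecay H a n) * pairDecayTail H a G) := by
  obtain ⟨K, hK, c, hc, hsup⟩ := exists_integral_exp_sup_le hB hH
  have hL : Tendsto (fun a : ℝ => exp (-(c * a ^ (H / 2))) * HH - K * a)
      (nhdsWithin 0 (Ioi 0)) (nhds HH) := by
    have : ContinuousAt (fun a : ℝ => exp (-(c * a ^ (H / 2))) * HH - K * a) 0 := by
      have := Real.continuousAt_rpow_const 0 (H / 2) (Or.inr (by positivity))
      fun_prop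
    have h2 := this.tendsto
    rw [zero_rpow (by positivity)] at h2
    simp only [mul_zero, neg_zero, exp_zero, one_mul, sub_zero] at h2
    exact h2.mono_left nhdsWithin_le_nhds
  have hL2 : Tendsto (fun a : ℝ => (exp (-(c * a ^ (H / 2))) * HH - K * a) ^ 2)
      (nhdsWithin 0 (Ioi 0)) (nhds (HH ^ 2)) := hL.pow 2
  have hlt : θ * HH ^ 2 < HH ^ 2 := by nlinarith [sq_pos_of_pos hHH]
  obtain ⟨a, ⟨⟨hLa, hLa2⟩, ha1⟩, ha⟩ := ((((hL.eventually (lt_mem_nhds hHH)).and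
    (hL2.eventually (lt_mem_nhds hlt))).and (nhdsWithin_le_nhds (Iic_mem_nhds one_pos))).and
      self_mem_nhdsWithin).exists
  replace ha : 0 < a := ha
  replace ha1 : a ≤ 1 := ha1
  set L := exp (-(c * a ^ (H / 2))) * HH - K * a with hLdef
  set S := ∑' n, pairDecay H a n with hS
  obtain ⟨G, hGτ, hG0⟩ : ∃ G : ℕ, 2 * S * pairDecayTail H a G / a ^ 2 < L ^ 2 - θ * HH ^ 2 ∧ 0 < G := by
    have h1 := ((tendsto_pairDecayTail hH ha).const_mul (2 * S)).div_const (a ^ 2)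
    rw [mul_zero, zero_div] at h1
    exact ((h1.eventually (gt_mem_nhds (sub_pos.2 hLa2))).and (eventually_gt_atTop 0)).exists
  set τ := 2 * S * pairDecayTail H a G with hτ
  set J : ℕ → ℝ := fun m => ((m : ℝ) * a)⁻¹ * ∫ ω, exp (⨆ t : Icc (0:ℝ) (m * a),
          (√2 * B (t:ℝ) ω - (t:ℝ) ^ (2*H))) ∂μ with hJ
  have hJt : Tendsto J atTop (nhds HH) :=
    hPick.comp (tendsto_natCast_atTop_atTop.atTop_mul_const ha)
  have hlow : Tendsto (fun m : ℕ => exp (-(c * a ^ (H / 2))) * J m - K * a) atTop (nhds L) :=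
    (hJt.const_mul _).sub_const _
  have hinv : Tendsto (fun m : ℕ => ((m : ℝ))⁻¹) atTop (nhds 0) := tendsto_inv_atTop_nhds_zero_nat
  have hF : Tendsto (fun m : ℕ => (exp (-(c * a ^ (H / 2))) * J m - K * a) ^ 2 -
      (1 + (m : ℝ)⁻¹) ^ 2 * (τ / a ^ 2) - θ * HH ^ 2 * (1 + G * (m : ℝ)⁻¹) ^ 2) atTop
      (nhds (L ^ 2 - (1 + 0) ^ 2 * (τ / a ^ 2) - θ * HH ^ 2 * (1 + G * 0) ^ 2)) :=
    ((hlow.pow 2).sub (((hinv.const_add 1).pow 2).mul_const _)).sub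
      ((((hinv.const_mul _).const_add 1).pow 2).const_mul _)
  have hFpos : 0 < L ^ 2 - (1 + 0) ^ 2 * (τ / a ^ 2) - θ * HH ^ 2 * (1 + G * 0) ^ 2 := by
    linarith
  obtain ⟨m, ⟨hm1, hm2⟩, hm0⟩ := (((hlow.eventually (lt_mem_nhds hLa)).and
    (hF.eventually (lt_mem_nhds hFpos))).and (eventually_gt_atTop 0)).exists
  have hm0' : (0 : ℝ) < m := by exact_mod_cast hm0
  have hfin : gridExpMax μ H B a m ≠ ⊤ :=
    ne_top_of_le_ne_top (by simp) (gridExpMax_le hB hH ha.le m)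
  set M := (gridExpMax μ H B a m).toReal with hM
  have hMlow : (m * a) * (exp (-(c * a ^ (H / 2))) * J m - K * a) ≤ M := by
    have h1 := hsup a ha ha1 m
    rw [← inv_mul_le_iff₀ (exp_pos _), ← exp_neg] at h1
    have h2 : (m * a) * J m = ∫ ω, exp (⨆ t : Icc (0:ℝ) (m * a),
          (√2 * B (t:ℝ) ω - (t:ℝ) ^ (2*H))) ∂μ := by
      rw [hJ]
      field_simp
    rw [← h2] at h1
    nlinarith
  have hsq : ((m * a) * (exp (-(c * a ^ (H / 2))) * J m - K * a)) ^ 2 ≤ M ^ 2 :=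
    pow_le_pow_left₀ (by positivity) hMlow 2
  have hfinal : θ * HH ^ 2 * (a * (m + G)) ^ 2 + (m + 1) ^ 2 * τ < M ^ 2 := by
    refine lt_of_lt_of_le ?_ hsq
    have h3 := mul_pos (show (0 : ℝ) < (m * a) ^ 2 by positivity) hm2
    have h4 : (m * a : ℝ) ^ 2 * ((exp (-(c * a ^ (H / 2))) * J m - K * a) ^ 2 -
      (1 + (m : ℝ)⁻¹) ^ 2 * (τ / a ^ 2) - θ * HH ^ 2 * (1 + G * (m : ℝ)⁻¹) ^ 2) =
      ((m * a) * (exp (-(c * a ^ (H / 2))) * J m - K * a)) ^ 2 - (m + 1) ^ 2 * τ -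
        θ * HH ^ 2 * (a * (m + G)) ^ 2 := by
      field_simp
    linarith
  obtain ⟨K', hK1, hK2⟩ := exists_between
    (max_lt hfinal (show 0 < M ^ 2 by nlinarith [mul_pos (mul_pos hm0' ha) hm1]))
  refine ⟨a, ha, m, G, hG0, K', (le_max_right _ _).trans hK1.le, ?_, ?_⟩
  · rw [ENNReal.ofReal_lt_iff_lt_toReal ((le_max_right _ _).trans hK1.le) (ENNReal.pow_ne_top hfin),
      ENNReal.toReal_pow]
    exact hK2
  · have := (le_max_left _ _).trans hK1.le
    linarith

lemma abs_rpow_sub_rpow_le {q x y : ℝ} (hq0 : 0 ≤ q) (hq1 : q ≤ 1) (hx : 1 / 2 ≤ x)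
    (hy : 1 / 2 ≤ y) : |x ^ q - y ^ q| ≤ 2 * |x - y| := by
  wlog hxy : y ≤ x generalizing x y
  · rw [abs_sub_comm, abs_sub_comm x]
    exact this hy hx (le_of_not_ge hxy)
  have hy0 : 0 < y := by linarith
  have hx0 : 0 < x := by linarith
  rw [abs_of_nonneg (sub_nonneg.2 (rpow_le_rpow hy0.le hxy hq0)), abs_of_nonneg (sub_nonneg.2 hxy)]
  have h1 : (x / y) ^ q ≤ x / y := by
    conv_rhs => rw [← rpow_one (x / y)]
    exact rpow_le_rpow_of_exponent_le ((one_le_div hy0).2 hxy) hq1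
  have h2 : x ^ q = y ^ q * (x / y) ^ q := by
    rw [← mul_rpow hy0.le (by positivity), mul_div_cancel₀ _ hy0.ne']
  have h3 : y ^ q = y ^ (q - 1) * y := by
    rw [← rpow_add_one hy0.ne', sub_add_cancel]
  have h4 : y ^ (q - 1) ≤ 2 := by
    calc y ^ (q - 1) ≤ (1 / 2) ^ (q - 1) := rpow_le_rpow_of_nonpos (by norm_num) hy (by linarith)
      _ = 2 ^ (1 - q) := by
        rw [one_div, inv_rpow (by norm_num), ← rpow_neg (by norm_num), neg_sub]
      _ ≤ 2 ^ (1 : ℝ) := rpow_le_rpow_of_exponent_le one_le_two (by linarith)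
      _ = 2 := rpow_one _
  calc x ^ q - y ^ q = y ^ q * ((x / y) ^ q - 1) := by rw [h2]; ring
    _ ≤ y ^ q * (x / y - 1) := by gcongr
    _ = y ^ (q - 1) * (x - y) := by rw [h3]; field_simp
    _ ≤ 2 * (x - y) := by gcongr

lemma abs_two_mul_one_sub_div_sub_le {x y p w δ σ ρ D : ℝ} (hρ8 : ρ < 1 / 8)
    (hδ0 : 0 ≤ δ) (hσ0 : 0 ≤ σ) (hδ : δ ≤ 2 * ρ) (hσ : σ ≤ 2 * ρ) (hx : |x - 1| ≤ 2 * ρ)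
    (hy : |y - 1| ≤ 2 * ρ) (hp : |x ^ 2 - p| ≤ 2 * σ) (hw : |y ^ 2 - w| ≤ 2 * σ)
    (hxy : |x - y| ≤ 2 * (δ + σ)) (hD : 0 ≤ D) :
    |2 * (1 - (p + w - D) / (2 * (x * y))) - D| ≤ 16 * (δ + σ) + 10 * ρ * D := by
  obtain ⟨hx1, hx2⟩ := abs_le.1 hx
  obtain ⟨hy1, hy2⟩ := abs_le.1 hy
  have hxy0 : 1 / 2 ≤ x * y := by
    have := mul_le_mul (show 3 / 4 ≤ x by linarith) (show 3 / 4 ≤ y by linarith) (by norm_num)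
      (by linarith)
    linarith
  have hxy1 : |1 - x * y| ≤ 5 * ρ := by
    have e : 1 - x * y = -((x - 1) + x * (y - 1)) := by ring
    rw [e, abs_neg]
    refine (abs_add_le _ _).trans ?_
    rw [abs_mul, abs_of_pos (show 0 < x by linarith)]
    have := mul_le_mul (show x ≤ 5 / 4 by linarith) hy (abs_nonneg _) (by norm_num)
    linarith
  have hsq : (x - y) ^ 2 ≤ 4 * (δ + σ) := by
    rw [← sq_abs]
    calc |x - y| ^ 2 ≤ (2 * (δ + σ)) ^ 2 := pow_le_pow_left₀ (abs_nonneg _) hxy 2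
      _ = 4 * (δ + σ) * (δ + σ) := by ring
      _ ≤ 4 * (δ + σ) * 1 := by gcongr; linarith
      _ = _ := mul_one _
  have hnum : |2 * (x * y) - p - w| ≤ 8 * (δ + σ) := by
    have e1 : 2 * (x * y) - p - w = (x ^ 2 - p) + (y ^ 2 - w) - (x - y) ^ 2 := by ring
    obtain ⟨a1, a2⟩ := abs_le.1 hp
    obtain ⟨b1, b2⟩ := abs_le.1 hw
    have := sq_nonneg (x - y)
    rw [e1, abs_le]
    constructor <;> linarith
  have key : 2 * (1 - (p + w - D) / (2 * (x * y))) - D =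
      (x * y)⁻¹ * ((2 * (x * y) - p - w) + D * (1 - x * y)) := by
    have hne : x * y ≠ 0 := by positivity
    generalize x * y = q at hne
    field_simp
    ring
  have hinv : (x * y)⁻¹ ≤ 2 := by
    rw [inv_le_comm₀ (by positivity) two_pos]
    linarith
  rw [key, abs_mul, abs_of_pos (by positivity : 0 < (x * y)⁻¹)]
  calc (x * y)⁻¹ * |(2 * (x * y) - p - w) + D * (1 - x * y)|
      ≤ 2 * (8 * (δ + σ) + D * (5 * ρ)) := by
        refine mul_le_mul hinv ((abs_add_le _ _).trans (add_le_add hnum ?_)) (abs_nonneg _)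
          zero_le_two
        rw [abs_mul, abs_of_nonneg hD]
        gcongr
    _ = _ := by ring

/-- Correlation of the increments of fractional Brownian motion over `[s, t]` and `[s', t']`. -/
noncomputable def incrCorr (H t s t' s' : ℝ) : ℝ :=
  (|t - s'| ^ (2*H) + |t' - s| ^ (2*H) - |t - t'| ^ (2*H) - |s - s'| ^ (2*H)) /
    (2 * ((t - s) ^ H * (t' - s') ^ H))

/-- Local behaviour of the correlation of increments of length close to one. -/
lemma exists_incrCorr_estimate {H : ℝ} (hH0 : 0 < H) (hH : H < 1 / 2) {κ : ℝ} (hκ : 0 < κ) :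
    ∃ ρ > 0, ∀ t s t' s' : ℝ, |t - s - 1| ≤ ρ → |t' - s - 1| ≤ ρ → |t - s' - 1| ≤ ρ →
      |t' - s' - 1| ≤ ρ → |2 * (1 - incrCorr H t s t' s') -
        (|t - t'| ^ (2*H) + |s - s'| ^ (2*H))| ≤ κ * (|t - t'| ^ (2*H) + |s - s'| ^ (2*H)) := by
  obtain ⟨ρ, ⟨hρκ, hρ8⟩, hρ⟩ : ∃ ρ : ℝ, (16 * (2 * ρ) ^ (1 - 2 * H) + 10 * ρ < κ ∧ ρ < 1 / 8) ∧ 0 < ρ := by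
    have h1 : ContinuousAt (fun ρ : ℝ => 16 * (2 * ρ) ^ (1 - 2 * H) + 10 * ρ) 0 := by
      have : Continuous fun ρ : ℝ => (2 * ρ) ^ (1 - 2 * H) :=
        (continuous_const.mul continuous_id).rpow_const fun _ => Or.inr (by linarith)
      fun_prop
    have h2 := h1.tendsto
    simp only [mul_zero, zero_rpow (by linarith : 1 - 2 * H ≠ 0), add_zero] at h2
    have h3 : ∀ᶠ ρ in nhdsWithin (0:ℝ) (Ioi 0), ρ ∈ Ioi (0:ℝ) := self_mem_nhdsWithin
    exact ((((h2.eventually (gt_mem_nhds hκ)).and (gt_mem_nhds (by norm_num : (0:ℝ) < 1 / 8))).filter_mono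
      nhdsWithin_le_nhds).and h3).exists
  refine ⟨ρ, hρ, fun t s t' s' h1 h2 h3 h4 => ?_⟩
  have hδ : |t - t'| ≤ 2 * ρ := by
    rw [abs_le] at *
    constructor <;> linarith
  have hσ : |s - s'| ≤ 2 * ρ := by
    rw [abs_le] at *
    constructor <;> linarith
  have hsmall : ∀ z : ℝ, |z| ≤ 2 * ρ → |z| ≤ (2 * ρ) ^ (1 - 2 * H) * |z| ^ (2 * H) := by
    intro z hz
    calc |z| = |z| ^ (1 - 2 * H) * |z| ^ (2 * H) := by
          rw [← rpow_add' (abs_nonneg z) (by simp)]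
          simp
      _ ≤ _ := by
          gcongr
          linarith
  have hδ' := hsmall _ hδ
  have hσ' := hsmall _ hσ
  set D := |t - t'| ^ (2*H) + |s - s'| ^ (2*H) with hD
  have hD0 : 0 ≤ D := by positivity
  obtain ⟨h1a, h1b⟩ := abs_le.1 h1
  obtain ⟨h2a, h2b⟩ := abs_le.1 h2
  obtain ⟨h3a, h3b⟩ := abs_le.1 h3
  obtain ⟨h4a, h4b⟩ := abs_le.1 h4
  have eX := abs_rpow_sub_rpow_le hH0.le (by linarith) (show 1 / 2 ≤ t - s by linarith)
    (show (1:ℝ) / 2 ≤ 1 by norm_num)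
  have eY := abs_rpow_sub_rpow_le hH0.le (by linarith) (show 1 / 2 ≤ t' - s' by linarith)
    (show (1:ℝ) / 2 ≤ 1 by norm_num)
  rw [one_rpow] at eX eY
  have eXY := abs_rpow_sub_rpow_le hH0.le (by linarith) (show 1 / 2 ≤ t - s by linarith)
    (show 1 / 2 ≤ t' - s' by linarith)
  have eP := abs_rpow_sub_rpow_le (q := 2 * H) (by linarith) (by linarith)
    (show 1 / 2 ≤ t - s by linarith) (show 1 / 2 ≤ t - s' by linarith)
  have eW := abs_rpow_sub_rpow_le (q := 2 * H) (by linarith) (by linarith)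
    (show 1 / 2 ≤ t' - s' by linarith) (show 1 / 2 ≤ t' - s by linarith)
  have sqX : (t - s) ^ (2 * H) = ((t - s) ^ H) ^ 2 := by
    rw [← rpow_natCast, ← rpow_mul (by linarith), mul_comm]
    simp
  have sqY : (t' - s') ^ (2 * H) = ((t' - s') ^ H) ^ 2 := by
    rw [← rpow_natCast, ← rpow_mul (by linarith), mul_comm]
    simp
  rw [sqX] at eP
  rw [sqY] at eW
  rw [show t - s - (t - s') = -(s - s') by ring, abs_neg] at eP
  rw [show t' - s' - (t' - s) = s - s' by ring] at eW
  have eXY2 : |(t - s) ^ H - (t' - s') ^ H| ≤ 2 * (|t - t'| + |s - s'|) := by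
    refine eXY.trans (mul_le_mul_of_nonneg_left ?_ zero_le_two)
    rw [show t - s - (t' - s') = (t - t') - (s - s') by ring]
    exact abs_sub _ _
  rw [incrCorr, abs_of_pos (show 0 < t - s' by linarith), abs_of_pos (show 0 < t' - s by linarith)]
  have halg := abs_two_mul_one_sub_div_sub_le hρ8 (abs_nonneg _) (abs_nonneg _) hδ hσ
    (eX.trans (mul_le_mul_of_nonneg_left h1 zero_le_two))
    (eY.trans (mul_le_mul_of_nonneg_left h4 zero_le_two)) eP eW eXY2 hD0
  rw [sub_sub, ← hD]
  refine halg.trans ?_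
  have h16 : |t - t'| + |s - s'| ≤ (2 * ρ) ^ (1 - 2 * H) * D := by
    rw [hD, mul_add]
    exact add_le_add hδ' hσ'
  calc 16 * (|t - t'| + |s - s'|) + 10 * ρ * D
      ≤ 16 * ((2 * ρ) ^ (1 - 2 * H) * D) + 10 * ρ * D := by gcongr
    _ = (16 * (2 * ρ) ^ (1 - 2 * H) + 10 * ρ) * D := by ring
    _ ≤ κ * D := by gcongr

/-- Normalised increments of a fractional Brownian motion form a Gaussian family. -/
lemma isGaussFam_incr {Ω ι : Type*} [MeasurableSpace Ω] [Fintype ι] {μ : Measure Ω} {H : ℝ}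
    {B : ℝ → Ω → ℝ} (hB : IsFbm μ H B) (t s : ι → ℝ) (ht : ∀ i, 0 ≤ t i) (hs : ∀ i, 0 ≤ s i) :
    IsGaussFam μ (fun i ω => (B (t i) ω - B (s i) ω) / (t i - s i) ^ H) 0
      (fun i j => incrCorr H (t i) (s i) (t j) (s j)) := by
  classical
  have h := (isGaussFam_fbm hB (Sum.elim t s) (fun i => by cases i <;> simp [ht, hs])).affine
    (fun k : ι => Sum.elim (fun i => if k = i then ((t k - s k) ^ H)⁻¹ else 0)
      (fun i => if k = i then -((t k - s k) ^ H)⁻¹ else 0)) 0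
  simp only [Fintype.sum_sum_type, Sum.elim_inl, Sum.elim_inr, Pi.zero_apply, mul_zero,
    Finset.sum_const_zero, add_zero, ite_mul, zero_mul, Finset.sum_ite_eq, Finset.mem_univ,
    if_true, mul_ite, Finset.sum_add_distrib] at h
  have h2 := h.congr (m' := 0) (C' := fun i j => incrCorr H (t i) (s i) (t j) (s j))
    (fun _ => rfl) (fun i j => by
      rw [incrCorr, div_eq_mul_inv _ (2 * _), mul_inv, mul_inv, abs_sub_comm (s i) (t j)]
      ring)
  convert h2 using 3
  ring

lemma incrCorr_self {H t s : ℝ} (hH : 0 < H) (hts : s < t) : incrCorr H t s t s = 1 := by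
  have h1 : (0 : ℝ) < (t - s) ^ H := rpow_pos_of_pos (by linarith) _
  rw [incrCorr, sub_self, sub_self, abs_zero, zero_rpow (by positivity), abs_of_pos (by linarith),
    two_mul H, rpow_add (by linarith)]
  field_simp
  ring

lemma incrCorr_comm (H t s t' s' : ℝ) : incrCorr H t s t' s' = incrCorr H t' s' t s := by
  rw [incrCorr, incrCorr, abs_sub_comm t t', abs_sub_comm s s', mul_comm ((t - s) ^ H)]
  ring

/-- The limiting field on a square grid: a sum of two independent drifted Brownian motions. -/
lemma isGaussFam_prod_drift {Ω : Type*} [MeasurableSpace Ω] {μ : Measure Ω}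
    [IsProbabilityMeasure μ] {H : ℝ} {B : ℝ → Ω → ℝ} (hB : IsFbm μ H B) {a : ℝ}
    (ha : 0 ≤ a) (m : ℕ) :
    IsGaussFam (μ.prod μ)
      (fun (i : Fin (m + 1) × Fin (m + 1)) ω =>
        (√2 * B (a * (i.1 : ℕ)) ω.1 - (a * (i.1 : ℕ)) ^ (2*H)) +
        (√2 * B (a * (i.2 : ℕ)) ω.2 - (a * (i.2 : ℕ)) ^ (2*H)))
      (fun i => -(|a * ((i.1 : ℕ) - ((0 : Fin (m + 1)) : ℕ) : ℝ)| ^ (2*H) +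
        |a * ((i.2 : ℕ) - ((0 : Fin (m + 1)) : ℕ) : ℝ)| ^ (2*H)))
      (fun i j => (|a * ((i.1 : ℕ) - ((0 : Fin (m + 1)) : ℕ) : ℝ)| ^ (2*H) +
          |a * ((i.2 : ℕ) - ((0 : Fin (m + 1)) : ℕ) : ℝ)| ^ (2*H)) +
        (|a * ((j.1 : ℕ) - ((0 : Fin (m + 1)) : ℕ) : ℝ)| ^ (2*H) +
          |a * ((j.2 : ℕ) - ((0 : Fin (m + 1)) : ℕ) : ℝ)| ^ (2*H)) -
        (|a * ((i.1 : ℕ) - (j.1 : ℕ) : ℝ)| ^ (2*H) +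
          |a * ((i.2 : ℕ) - (j.2 : ℕ) : ℝ)| ^ (2*H))) := by
  refine ((isGaussFam_drift hB (fun i : Fin (m + 1) × Fin (m + 1) => a * (i.1 : ℕ))
    (fun i => by positivity)).prod_add (isGaussFam_drift hB
      (fun i : Fin (m + 1) × Fin (m + 1) => a * (i.2 : ℕ)) (fun i => by positivity))).congr ?_ ?_
  · intro i
    simp only [Fin.val_zero, Nat.cast_zero, sub_zero]
    rw [abs_of_nonneg (by positivity), abs_of_nonneg (by positivity)]
    ring
  · intro i j
    simp only [Fin.val_zero, Nat.cast_zero, sub_zero]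
    rw [abs_of_nonneg (a := a * (i.1 : ℕ)) (by positivity),
      abs_of_nonneg (a := a * (i.2 : ℕ)) (by positivity),
      abs_of_nonneg (a := a * (j.1 : ℕ)) (by positivity),
      abs_of_nonneg (a := a * (j.2 : ℕ)) (by positivity), mul_sub, mul_sub]
    ring

lemma gridExpMax_sq_le {Ω : Type*} [MeasurableSpace Ω] {μ : Measure Ω} [IsProbabilityMeasure μ]
    {B : ℝ → Ω → ℝ} (hB : ∀ t, Measurable (B t)) (H a : ℝ) (m : ℕ) :
    gridExpMax μ H B a m ^ 2 ≤ ∫⁻ ω, ENNReal.ofReal (exp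
      (⨆ i : Fin (m + 1) × Fin (m + 1),
        ((√2 * B (a * (i.1 : ℕ)) ω.1 - (a * (i.1 : ℕ)) ^ (2*H)) +
        (√2 * B (a * (i.2 : ℕ)) ω.2 - (a * (i.2 : ℕ)) ^ (2*H))))) ∂(μ.prod μ) := by
  have hm : Measurable fun ω => ENNReal.ofReal (exp (⨆ i : Fin (m + 1),
      (√2 * B (a * (i : ℕ)) ω - (a * (i : ℕ)) ^ (2*H)))) := by
    have : Measurable fun ω => ⨆ i : Fin (m + 1),
        (√2 * B (a * (i : ℕ)) ω - (a * (i : ℕ)) ^ (2*H)) := Measurable.iSup fun i => by fun_prop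
    fun_prop
  rw [sq, gridExpMax, ← lintegral_prod_mul hm.aemeasurable hm.aemeasurable]
  refine lintegral_mono fun ω => ?_
  dsimp only
  rw [← ENNReal.ofReal_mul (exp_pos _).le, ← exp_add]
  refine ENNReal.ofReal_le_ofReal (exp_le_exp.2 ?_)
  obtain ⟨i, hi⟩ := exists_eq_ciSup_of_finite (f := fun i : Fin (m + 1) =>
    √2 * B (a * (i : ℕ)) ω.1 - (a * (i : ℕ)) ^ (2*H))
  obtain ⟨j, hj⟩ := exists_eq_ciSup_of_finite (f := fun i : Fin (m + 1) =>
    √2 * B (a * (i : ℕ)) ω.2 - (a * (i : ℕ)) ^ (2*H))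
  rw [← hi, ← hj]
  exact le_ciSup (f := fun i : Fin (m + 1) × Fin (m + 1) =>
    (√2 * B (a * (i.1 : ℕ)) ω.1 - (a * (i.1 : ℕ)) ^ (2*H)) +
        (√2 * B (a * (i.2 : ℕ)) ω.2 - (a * (i.2 : ℕ)) ^ (2*H))) (Finite.bddAbove_range _) (i, j)

/-- Bonferroni's inequality. -/
lemma sum_measureReal_sub_le {Ω ι : Type*} [MeasurableSpace Ω] {μ : Measure Ω}
    [IsFiniteMeasure μ] [DecidableEq ι] {E : ι → Set Ω} (hE : ∀ i, MeasurableSet (E i))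
    (s : Finset ι) :
    ∑ i ∈ s, (μ.real (E i) - ∑ j ∈ s.erase i, μ.real (E i ∩ E j)) ≤ μ.real (⋃ i ∈ s, E i) := by
  induction s using Finset.induction_on with
  | empty => simp
  | insert a s ha ih =>
    have h1 : μ.real (E a ∩ ⋃ i ∈ s, E i) ≤ ∑ j ∈ s, μ.real (E a ∩ E j) := by
      rw [inter_iUnion₂]
      exact measureReal_biUnion_finset_le s _
    have h2 := measureReal_union_add_inter (μ := μ) (s := E a) (t := ⋃ i ∈ s, E i)
      (Finset.measurableSet_biUnion s fun i _ => hE i)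
      (measure_ne_top _ _) (measure_ne_top _ _)
    have h3 : ∀ i ∈ s, μ.real (E i) - ∑ j ∈ (insert a s).erase i, μ.real (E i ∩ E j) ≤
        μ.real (E i) - ∑ j ∈ s.erase i, μ.real (E i ∩ E j) := by
      intro i _
      gcongr
      exact Finset.subset_insert a s
    rw [Finset.sum_insert ha, Finset.erase_insert ha, Finset.set_biUnion_insert]
    linarith [Finset.sum_le_sum h3]

lemma sum_comp_le_tsum {ι : Type*} [Fintype ι] {f : ℤ → ℝ} (hf : Summable f) (hf0 : ∀ n, 0 ≤ f n)
    {g : ι → ℤ} (hg : g.Injective) : ∑ i, f (g i) ≤ ∑' n, f n := by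
  rw [← tsum_fintype (L := SummationFilter.unconditional _)]
  exact tsum_comp_le_tsum_of_inj hf hf0 hg

/-- The position of the point `i.2` of block `i.1` when consecutive blocks of `m + 1` points have
starting points at distance `m + G`. -/
def blockPos {n m : ℕ} (G : ℕ) (b : Fin n) (i : Fin (m + 1)) : ℕ := (m + G) * b + i

lemma blockPos_sub_abs {n m G : ℕ} {b b' : Fin n} (hb : b ≠ b') (i i' : Fin (m + 1)) :
    (G : ℤ) ≤ |((blockPos G b i : ℤ) - blockPos G b' i')| := by
  have hi := i.is_le
  have hi' := i'.is_le
  have hbb : (b : ℕ) ≠ b' := fun h => hb (Fin.ext h)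
  zify at hi hi' hbb
  simp only [blockPos]
  push_cast
  have hmG : (0 : ℤ) ≤ m + G := by positivity
  rcases lt_or_gt_of_ne hbb with h | h
  · have : ((m : ℤ) + G) * (b + 1) ≤ (m + G) * b' := mul_le_mul_of_nonneg_left (by omega) hmG
    rw [abs_sub_comm]
    refine le_trans ?_ (le_abs_self _)
    linarith [(Int.natCast_nonneg (i' : ℕ))]
  · have : ((m : ℤ) + G) * (b' + 1) ≤ (m + G) * b := mul_le_mul_of_nonneg_left (by omega) hmG
    refine le_trans ?_ (le_abs_self _)
    linarith [(Int.natCast_nonneg (i : ℕ))]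

lemma blockPos_injective {n m G : ℕ} (hG : 0 < G) :
    Function.Injective fun j : Fin n × Fin (m + 1) => blockPos G j.1 j.2 := by
  rintro ⟨b, i⟩ ⟨b', i'⟩ h
  dsimp only at h
  obtain rfl : b = b' := by
    by_contra hb
    have := blockPos_sub_abs (G := G) hb i i'
    simp [h] at this
    omega
  simp only [blockPos, add_right_inj] at h
  rw [Fin.ext h]

/-- Points of different blocks have a summable total interaction. -/
lemma sum_pairDecay_le {H a : ℝ} (hH : 0 < H) (ha : 0 < a) {n m G : ℕ} (hG : 0 < G)
    (b : Fin n × Fin n) (i : Fin (m + 1) × Fin (m + 1)) :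
    ∑ b' ∈ Finset.univ.erase b, ∑ i' : Fin (m + 1) × Fin (m + 1),
      pairDecay H a ((blockPos G b.1 i.1 : ℤ) - blockPos G b'.1 i'.1) *
      pairDecay H a ((blockPos G b.2 i.2 : ℤ) - blockPos G b'.2 i'.2) ≤
    2 * (∑' n, pairDecay H a n) * pairDecayTail H a G := by
  have hprod : ∀ f g : ℤ → ℝ, Summable f → Summable g → (∀ n, 0 ≤ f n) → (∀ n, 0 ≤ g n) →
      ∑ b' : Fin n × Fin n, ∑ i' : Fin (m + 1) × Fin (m + 1),
        f ((blockPos G b.1 i.1 : ℤ) - blockPos G b'.1 i'.1) *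
        g ((blockPos G b.2 i.2 : ℤ) - blockPos G b'.2 i'.2) ≤ (∑' n, f n) * ∑' n, g n := by
    intro f g hf hg hf0 hg0
    have hinj : ∀ x : ℤ, Function.Injective
        fun j : Fin n × Fin (m + 1) => x - (blockPos G j.1 j.2 : ℤ) := by
      intro x j j' h
      refine blockPos_injective hG ?_
      dsimp only at h ⊢
      omega
    have h1 := sum_comp_le_tsum hf hf0 (hinj (blockPos G b.1 i.1))
    have h2 := sum_comp_le_tsum hg hg0 (hinj (blockPos G b.2 i.2))
    refine le_trans (le_of_eq ?_) (mul_le_mul h1 h2 (Finset.sum_nonneg fun _ _ => hg0 _)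
      (tsum_nonneg hf0))
    simp only [Fintype.sum_prod_type, Finset.sum_mul_sum]
  set T : ℤ → ℝ := fun n => if (G : ℤ) ≤ |n| then pairDecay H a n else 0 with hT
  have hT0 : ∀ n, 0 ≤ T n := fun n => by
    rw [hT]
    dsimp only
    split_ifs
    exacts [(pairDecay_pos H a n).le, le_rfl]
  have h0 : ∀ n, 0 ≤ pairDecay H a n := fun n => (pairDecay_pos H a n).le
  have hs := summable_pairDecay hH ha
  have hTs : Summable T := summable_pairDecayTail hH ha G
  have h1 := hprod T _ hTs hs hT0 h0
  have h2 := hprod _ T hs hTs h0 hT0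
  have htail : ∑' n, T n = pairDecayTail H a G := rfl
  rw [htail] at h1 h2
  refine le_trans ?_ (le_trans (add_le_add h1 h2) (le_of_eq (by ring)))
  rw [← Finset.sum_add_distrib]
  refine le_trans (Finset.sum_le_sum (g := fun b' : Fin n × Fin n =>
    ∑ i' : Fin (m + 1) × Fin (m + 1), (T ((blockPos G b.1 i.1 : ℤ) - blockPos G b'.1 i'.1) *
      pairDecay H a ((blockPos G b.2 i.2 : ℤ) - blockPos G b'.2 i'.2) +
      pairDecay H a ((blockPos G b.1 i.1 : ℤ) - blockPos G b'.1 i'.1) *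
      T ((blockPos G b.2 i.2 : ℤ) - blockPos G b'.2 i'.2))) fun b' hb' => ?_) ?_
  · refine Finset.sum_le_sum fun i' _ => ?_
    have hne : b.1 ≠ b'.1 ∨ b.2 ≠ b'.2 := by
      by_contra! h
      exact (Finset.ne_of_mem_erase hb') (Prod.ext h.1 h.2).symm
    rcases hne with h | h
    · have := blockPos_sub_abs (G := G) h i.1 i'.1
      rw [show T ((blockPos G b.1 i.1 : ℤ) - blockPos G b'.1 i'.1) = _ from if_pos this]
      exact le_add_of_nonneg_right (mul_nonneg (h0 _) (hT0 _))
    · have := blockPos_sub_abs (G := G) h i.2 i'.2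
      rw [show T ((blockPos G b.2 i.2 : ℤ) - blockPos G b'.2 i'.2) = _ from if_pos this]
      exact le_add_of_nonneg_left (mul_nonneg (hT0 _) (h0 _))
  · simp only [Finset.sum_add_distrib]
    exact add_le_add
      (Finset.sum_le_sum_of_subset_of_nonneg (Finset.erase_subset _ _) fun _ _ _ =>
        Finset.sum_nonneg fun _ _ => mul_nonneg (hT0 _) (h0 _))
      (Finset.sum_le_sum_of_subset_of_nonneg (Finset.erase_subset _ _) fun _ _ _ =>
        Finset.sum_nonneg fun _ _ => mul_nonneg (h0 _) (hT0 _))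

/-- The limiting variogram of the scaled field between two points of a block grid. -/
noncomputable def blockDist (H a : ℝ) {n m : ℕ} (G : ℕ)
    (x y : (Fin n × Fin n) × (Fin (m + 1) × Fin (m + 1))) : ℝ :=
  |a * ((blockPos G x.1.1 x.2.1 : ℝ) - blockPos G y.1.1 y.2.1)| ^ (2*H) +
    |a * ((blockPos G x.1.2 x.2.2 : ℝ) - blockPos G y.1.2 y.2.2)| ^ (2*H)

/-- Lower bound for the exceedance probability over a grid made of `n ^ 2` separated blocks. -/
lemma exists_grid_lower_bound {Ω : Type*} [MeasurableSpace Ω] {μ : Measure Ω}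
    [IsProbabilityMeasure μ] {H : ℝ} {B : ℝ → Ω → ℝ} (hB : IsFbm μ H B) (hH : 0 < H) {a : ℝ}
    (ha : 0 < a) {m G : ℕ} (hG : 0 < G) {K : ℝ} (hK0 : 0 ≤ K)
    (hK : ENNReal.ofReal K < gridExpMax μ H B a m ^ 2) :
    ∃ κ > 0, ∃ V, ∀ v ≥ V, ∀ (n : ℕ)
      (X : (Fin n × Fin n) × (Fin (m + 1) × Fin (m + 1)) → Ω → ℝ)
      (r : (Fin n × Fin n) × (Fin (m + 1) × Fin (m + 1)) →
        (Fin n × Fin n) × (Fin (m + 1) × Fin (m + 1)) → ℝ),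
      IsGaussFam μ X 0 r → (∀ x, r x x = 1) → (∀ x y, r x y = r y x) → (∀ x y, 0 ≤ r x y) →
      (∀ x y, |v ^ 2 * (1 - r x y) - blockDist H a G x y| ≤ κ * blockDist H a G x y) →
      (n : ℝ) ^ 2 * (K - (m + 1) ^ 2 * (2 * (∑' n, pairDecay H a n) * pairDecayTail H a G)) *
        stdNormalTail v ≤ μ.real {ω | ∃ x, v < X x ω} := by
  obtain ⟨κ, hκ, V, hV⟩ := exists_exceed_lower_bound (μ' := μ.prod μ) μ
    (D := fun i j : Fin (m + 1) × Fin (m + 1) => |a * ((i.1 : ℕ) - (j.1 : ℕ) : ℝ)| ^ (2*H) +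
          |a * ((i.2 : ℕ) - (j.2 : ℕ) : ℝ)| ^ (2*H)) (0, 0)
    (isGaussFam_prod_drift hB ha.le m) hK0 (hK.trans_le (gridExpMax_sq_le hB.meas H a m))
  set M := 2 * (a * (m + 1)) ^ (2*H) with hM
  have hM0 : 0 < M := by positivity
  refine ⟨min (1/2) (κ / M), by positivity, max V 0, ?_⟩
  intro v hv n X r hX hd hs hr hXr
  have hv0 : 0 ≤ v := (le_max_right _ _).trans hv
  have hΨ := (stdNormalTail_pos v).le
  set E : Fin n × Fin n → Set Ω := fun b => {ω | ∃ i, v < X (b, i) ω} with hE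
  have hEm : ∀ b, MeasurableSet (E b) := by
    intro b
    simp only [hE, ofPred_exists]
    exact MeasurableSet.iUnion fun i => measurableSet_lt measurable_const (hX.meas _)
  have hsub : ∀ b, IsGaussFam μ (fun i => X (b, i)) 0 (fun i j => r (b, i) (b, j)) := by
    intro b
    classical
    have h := hX.affine (fun (i : Fin (m + 1) × Fin (m + 1)) x => if (b, i) = x then 1 else 0) 0
    simp only [ite_mul, zero_mul, one_mul, Finset.sum_ite_eq, Finset.mem_univ, if_true,
      Pi.zero_apply, mul_zero, Finset.sum_const_zero, add_zero] at h
    exact h.congr (fun _ => rfl) (fun i j => by simp)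
  have hblock : ∀ b, K * stdNormalTail v ≤ μ.real (E b) := by
    intro b
    refine hV v ((le_max_left _ _).trans hv) _ _ (hsub b) (fun _ => hd _) (fun _ _ => hs _ _)
      fun i j => ?_
    have h1 : ∀ i j : Fin (m + 1),
        |a * ((i : ℕ) - (j : ℕ) : ℝ)| ^ (2*H) ≤ (a * (m + 1)) ^ (2*H) := by
      intro i j
      refine rpow_le_rpow (abs_nonneg _) ?_ (by positivity)
      rw [abs_mul, abs_of_pos ha]
      gcongr
      have hi : (i : ℝ) ≤ m := by exact_mod_cast i.is_le
      have hj : (j : ℝ) ≤ m := by exact_mod_cast j.is_le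
      have hi0 : (0 : ℝ) ≤ (i : ℕ) := by positivity
      have hj0 : (0 : ℝ) ≤ (j : ℕ) := by positivity
      rw [abs_le]
      constructor <;> linarith
    have h2 : blockDist H a G (b, i) (b, j) = |a * ((i.1 : ℕ) - (j.1 : ℕ) : ℝ)| ^ (2*H) +
          |a * ((i.2 : ℕ) - (j.2 : ℕ) : ℝ)| ^ (2*H) := by
      simp [blockDist, blockPos]
    have h3 := hXr (b, i) (b, j)
    rw [h2] at h3
    refine h3.trans ?_
    calc _ ≤ κ / M * M := by
          refine mul_le_mul (min_le_right _ _) ?_ (by positivity) (by positivity)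
          linarith [h1 i.1 j.1, h1 i.2 j.2]
      _ = κ := div_mul_cancel₀ _ hM0.ne'
  have hpair : ∀ x y, μ.real {ω | v < X x ω ∧ v < X y ω} ≤
      pairDecay H a ((blockPos G x.1.1 x.2.1 : ℤ) - blockPos G y.1.1 y.2.1) *
      pairDecay H a ((blockPos G x.1.2 x.2.2 : ℤ) - blockPos G y.1.2 y.2.2) *
        stdNormalTail v := by
    intro x y
    refine (hX.measure_pair_le (hd x) (hd y) (hs x y) (hr x y) hv0).trans ?_
    gcongr
    rw [pairDecay, pairDecay, ← exp_add]
    refine exp_le_exp.2 ?_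
    have h1 := (abs_le.1 (hXr x y)).1
    have h2 : 0 ≤ blockDist H a G x y := by unfold blockDist; positivity
    have h3 := mul_le_mul_of_nonneg_right (min_le_left (1/2) (κ / M)) h2
    simp only [blockDist] at h1 h3
    push_cast
    linarith
  have hinter : ∀ b, ∑ b' ∈ Finset.univ.erase b, μ.real (E b ∩ E b') ≤
      (m + 1) ^ 2 * (2 * (∑' n, pairDecay H a n) * pairDecayTail H a G) * stdNormalTail v := by
    intro b
    calc _ ≤ ∑ b' ∈ Finset.univ.erase b, ∑ i, ∑ i',
          μ.real {ω | v < X (b, i) ω ∧ v < X (b', i') ω} := by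
          refine Finset.sum_le_sum fun b' _ => ?_
          have : E b ∩ E b' = ⋃ i, ⋃ i', {ω | v < X (b, i) ω ∧ v < X (b', i') ω} := by
            ext ω
            simp [hE]
          rw [this]
          exact (measureReal_iUnion_fintype_le _).trans
            (Finset.sum_le_sum fun i _ => measureReal_iUnion_fintype_le _)
      _ = ∑ i, ∑ b' ∈ Finset.univ.erase b, ∑ i',
          μ.real {ω | v < X (b, i) ω ∧ v < X (b', i') ω} := Finset.sum_comm
      _ ≤ ∑ i : Fin (m + 1) × Fin (m + 1),
          2 * (∑' n, pairDecay H a n) * pairDecayTail H a G * stdNormalTail v := by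
          refine Finset.sum_le_sum fun i _ => ?_
          refine le_trans ?_ (mul_le_mul_of_nonneg_right (sum_pairDecay_le hH ha hG b i) hΨ)
          simp only [Finset.sum_mul]
          exact Finset.sum_le_sum fun b' _ => Finset.sum_le_sum fun i' _ =>
            hpair (b, i) (b', i')
      _ = _ := by
          simp
          ring
  have hU : {ω | ∃ x, v < X x ω} = ⋃ b ∈ (Finset.univ : Finset (Fin n × Fin n)), E b := by
    ext ω
    simp [hE]
  rw [hU]
  refine le_trans ?_ (sum_measureReal_sub_le hEm Finset.univ)
  calc _ = ∑ b : Fin n × Fin n, (K * stdNormalTail v - (m + 1) ^ 2 *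
        (2 * (∑' n, pairDecay H a n) * pairDecayTail H a G) * stdNormalTail v) := by
        simp
        ring
    _ ≤ _ := Finset.sum_le_sum fun b _ => sub_le_sub (hblock b) (hinter b)

lemma sub_le_supYOnRect {Ω : Type*} {B : ℝ → Ω → ℝ} {ω : Ω} (h : Continuous fun t => B t ω)
    {t₁ t₂ s₁ s₂ t s : ℝ} (ht : t ∈ Icc t₁ t₂) (hs : s ∈ Icc s₁ s₂) :
    B t ω - B s ω ≤ supYOnRect B t₁ t₂ s₁ s₂ ω := by
  obtain ⟨M, hM⟩ := isCompact_Icc.bddAbove_image (h.continuousOn (s := Icc t₁ t₂))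
  obtain ⟨N, hN⟩ := isCompact_Icc.bddBelow_image (h.continuousOn (s := Icc s₁ s₂))
  have hle : ∀ (t : Icc t₁ t₂) (s : Icc s₁ s₂), B t ω - B s ω ≤ M - N := fun t s =>
    sub_le_sub (hM (mem_image_of_mem _ t.2)) (hN (mem_image_of_mem _ s.2))
  have : Nonempty (Icc s₁ s₂) := ⟨⟨s, hs⟩⟩
  exact (le_ciSup (f := fun s : Icc s₁ s₂ => B t ω - B s ω)
    ⟨M - N, by rintro _ ⟨s, rfl⟩; exact hle ⟨t, ht⟩ s⟩ ⟨s, hs⟩).trans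
    (le_ciSup (f := fun t : Icc t₁ t₂ => ⨆ s : Icc s₁ s₂, (B (t : ℝ) ω - B s ω))
      ⟨M - N, by rintro _ ⟨t, rfl⟩; exact ciSup_le (hle t)⟩ ⟨t, ht⟩)

lemma blockPos_le {n m G : ℕ} (hG : 0 < G) (b : Fin n) (i : Fin (m + 1)) :
    blockPos G b i ≤ n * (m + G) := by
  have h1 : (m + G) * (b + 1) ≤ (m + G) * n := Nat.mul_le_mul_left _ b.is_lt
  have h2 := i.is_le
  rw [blockPos, mul_comm n]
  linarith

/-- Lower bound for the exceedance probability of the increments over a small square, in terms of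
a grid of `n ^ 2` blocks fitting into that square. -/
lemma exists_rect_lower_bound {Ω : Type*} [MeasurableSpace Ω] {μ : Measure Ω}
    [IsProbabilityMeasure μ] {H : ℝ} {B : ℝ → Ω → ℝ} (hB : IsFbm μ H B) (hH0 : 0 < H)
    (hH : H < 1 / 2) {a : ℝ} (ha : 0 < a) {m G : ℕ} (hG : 0 < G) {K : ℝ} (hK0 : 0 ≤ K)
    (hK : ENNReal.ofReal K < gridExpMax μ H B a m ^ 2) :
    ∃ ρ > 0, ∃ V, ∀ v ≥ V, ∀ t₀ s₀ R u q : ℝ, 0 ≤ t₀ → 0 ≤ s₀ → 0 ≤ R → |t₀ - s₀ - 1| + R ≤ ρ →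
      u ≤ v * (t₀ - R - s₀) ^ H → 0 ≤ q → v ^ 2 * q ^ (2*H) = 2 →
      ∀ n : ℕ, q * a * (n * (m + G)) ≤ R →
      (n : ℝ) ^ 2 * (K - (m + 1) ^ 2 * (2 * (∑' n, pairDecay H a n) * pairDecayTail H a G)) *
        stdNormalTail v ≤ μ.real {ω | u < supYOnRect B t₀ (t₀ + R) s₀ (s₀ + R) ω} := by
  obtain ⟨κ, hκ, V, hV⟩ := exists_grid_lower_bound hB hH0 ha hG hK0 hK
  obtain ⟨ρ, hρ, hρE⟩ := exists_incrCorr_estimate hH0 hH (κ := min κ 1) (by positivity)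
  refine ⟨min ρ (min (1/4) ((1/2) ^ (1 / (2*H)))), by positivity, max V 0, ?_⟩
  intro v hv t₀ s₀ R u q ht₀ hs₀ hR hclose hu hq hvq n hn
  have hv0 : 0 ≤ v := (le_max_right _ _).trans hv
  obtain ⟨hc1, hc2⟩ := le_min_iff.1 hclose
  obtain ⟨hc2, hc3⟩ := le_min_iff.1 hc2
  have habs := abs_nonneg (t₀ - s₀ - 1)
  have hR1 : R ^ (2*H) ≤ 1/2 := by
    calc R ^ (2*H) ≤ ((1/2) ^ (1 / (2*H))) ^ (2*H) :=
          rpow_le_rpow hR (by linarith) (by positivity)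
      _ = 1/2 := by
        rw [← rpow_mul (by norm_num), one_div_mul_cancel (by positivity), rpow_one]
  have hpos : ∀ (b : Fin n) (i : Fin (m + 1)), 0 ≤ q * a * blockPos G b i ∧
      q * a * blockPos G b i ≤ R := by
    intro b i
    refine ⟨by positivity, le_trans ?_ hn⟩
    have : (blockPos G b i : ℝ) ≤ n * (m + G) := by exact_mod_cast blockPos_le hG b i
    gcongr
  set t : (Fin n × Fin n) × (Fin (m + 1) × Fin (m + 1)) → ℝ :=
    fun x => t₀ + q * a * blockPos G x.1.1 x.2.1 with ht
  set s : (Fin n × Fin n) × (Fin (m + 1) × Fin (m + 1)) → ℝ :=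
    fun x => s₀ + q * a * blockPos G x.1.2 x.2.2 with hs
  have htR : ∀ x, t x ∈ Icc t₀ (t₀ + R) := fun x => by
    have := hpos x.1.1 x.2.1
    constructor <;> simp only [ht] <;> linarith
  have hsR : ∀ x, s x ∈ Icc s₀ (s₀ + R) := fun x => by
    have := hpos x.1.2 x.2.2
    constructor <;> simp only [hs] <;> linarith
  have hdiff : ∀ x y, |t x - s y - 1| ≤ |t₀ - s₀ - 1| + R := by
    intro x y
    have h1 := htR x
    have h2 := hsR y
    have h3 := abs_le.1 (le_refl |t₀ - s₀ - 1|)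
    rw [abs_le]
    constructor <;> linarith [h1.1, h1.2, h2.1, h2.2]
  have hts : ∀ x, s x < t x := fun x => by
    have := (abs_le.1 (hdiff x x)).1
    linarith
  have hscale : ∀ x y, blockDist H a G x y =
      v ^ 2 / 2 * (|t x - t y| ^ (2*H) + |s x - s y| ^ (2*H)) := by
    intro x y
    have h1 : ∀ z w : ℝ, v ^ 2 / 2 * |q * a * z - q * a * w| ^ (2*H) =
        |a * (z - w)| ^ (2*H) := by
      intro z w
      rw [← mul_sub, mul_assoc, abs_mul, abs_of_nonneg hq, mul_rpow hq (abs_nonneg _),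
        ← mul_assoc, div_mul_eq_mul_div, hvq]
      ring
    simp only [ht, hs, add_sub_add_left_eq_sub]
    rw [mul_add, h1, h1, blockDist]
  have hest := fun x y => hρE (t x) (s x) (t y) (s y) ((hdiff x x).trans hc1)
    ((hdiff y x).trans hc1) ((hdiff x y).trans hc1) ((hdiff y y).trans hc1)
  have hD0 : ∀ x y, 0 ≤ |t x - t y| ^ (2*H) + |s x - s y| ^ (2*H) := fun x y => by positivity
  have hr0 : ∀ x y, 0 ≤ incrCorr H (t x) (s x) (t y) (s y) := by
    intro x y
    have h1 : |t x - t y| ^ (2*H) ≤ R ^ (2*H) := by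
      refine rpow_le_rpow (abs_nonneg _) ?_ (by positivity)
      rw [abs_le]
      constructor <;> linarith [(htR x).1, (htR x).2, (htR y).1, (htR y).2]
    have h2 : |s x - s y| ^ (2*H) ≤ R ^ (2*H) := by
      refine rpow_le_rpow (abs_nonneg _) ?_ (by positivity)
      rw [abs_le]
      constructor <;> linarith [(hsR x).1, (hsR x).2, (hsR y).1, (hsR y).2]
    have h3 := (abs_le.1 (hest x y)).2
    have h4 := mul_le_mul_of_nonneg_right (min_le_right κ 1) (hD0 x y)
    linarith
  have hmain := hV v ((le_max_left _ _).trans hv) n _ _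
    (isGaussFam_incr hB t s (fun x => ht₀.trans (htR x).1) (fun x => hs₀.trans (hsR x).1))
    (fun x => incrCorr_self hH0 (hts x)) (fun x y => incrCorr_comm _ _ _ _ _) hr0
    (fun x y => by
      rw [hscale x y]
      have h5 : v ^ 2 * (1 - incrCorr H (t x) (s x) (t y) (s y)) -
          v ^ 2 / 2 * (|t x - t y| ^ (2*H) + |s x - s y| ^ (2*H)) = v ^ 2 / 2 *
          (2 * (1 - incrCorr H (t x) (s x) (t y) (s y)) -
            (|t x - t y| ^ (2*H) + |s x - s y| ^ (2*H))) := by ring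
      rw [h5, abs_mul, abs_of_nonneg (by positivity), mul_left_comm]
      refine mul_le_mul_of_nonneg_left ((hest x y).trans ?_) (by positivity)
      exact mul_le_mul_of_nonneg_right (min_le_left _ _) (hD0 x y))
  refine hmain.trans (ENNReal.toReal_mono (measure_ne_top _ _) (measure_mono_ae ?_))
  filter_upwards [hB.cont] with ω hω
  rintro ⟨x, hx⟩
  refine lt_of_lt_of_le ?_ (sub_le_supYOnRect hω (htR x) (hsR x))
  have hpos : 0 < t x - s x := sub_pos.2 (hts x)
  rw [lt_div_iff₀ (by positivity)] at hx
  refine (hu.trans ?_).trans_lt hx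
  refine mul_le_mul_of_nonneg_left (rpow_le_rpow ?_ ?_ hH0.le) hv0
  · have := (abs_le.1 (le_refl |t₀ - s₀ - 1|)).1
    linarith
  · linarith [(htR x).1, (hsR x).2]

lemma one_sub_le_rpow {H ε x : ℝ} (hH : 0 < H) (hε : 0 < ε) (hx : 0 ≤ x)
    (hxε : x ≤ ε / (H + ε)) : 1 - (H + ε) * x ≤ (1 - x) ^ H := by
  have h0 : x * (H + ε) ≤ ε := (le_div_iff₀ (by positivity)).1 hxε
  have hx1 : 0 < 1 - x := by
    by_contra! h
    nlinarith
  have h1 := one_sub_inv_le_log_of_pos hx1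
  rw [rpow_def_of_pos hx1]
  refine le_trans ?_ (add_one_le_exp _)
  have h2 : (1 - x)⁻¹ * H ≤ H + ε := by
    rw [inv_mul_le_iff₀ hx1]
    linarith
  have h3 : 1 - (1 - x)⁻¹ = -(x * (1 - x)⁻¹) := by
    field_simp
    ring
  have h4 := mul_le_mul_of_nonneg_left h2 hx
  nlinarith

lemma tendsto_log_sq_div_sq : Tendsto (fun u : ℝ => log u ^ 2 / u ^ 2) atTop (nhds 0) := by
  have h1 := (isLittleO_log_id_atTop.tendsto_div_nhds_zero).pow 2
  simpa [div_pow] using h1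

/-- Counting the blocks of side `p` which fit into an interval of length `y`, up to a factor. -/
lemma mul_sq_le_floor_sq {c θ p y : ℝ} (hc : 0 ≤ c) (hcθ : c < θ) (hp : 0 < p)
    (hy : p / (1 - √(c / θ)) ≤ y) : c * y ^ 2 ≤ (⌊y / p⌋₊ : ℝ) ^ 2 * (θ * p ^ 2) := by
  have hθ : 0 < θ := hc.trans_lt hcθ
  have h1 : √(c / θ) < 1 := by
    rw [sqrt_lt' one_pos, one_pow, div_lt_one hθ]
    exact hcθ
  have hy0 : 0 < y := lt_of_lt_of_le (div_pos hp (by linarith)) hy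
  rw [div_le_iff₀ (by linarith)] at hy
  have h2 : y - p ≤ ⌊y / p⌋₊ * p := by
    have := (Nat.lt_floor_add_one (y / p)).le
    rw [div_le_iff₀ hp] at this
    linarith
  have h3 : √(c / θ) * y ≤ ⌊y / p⌋₊ * p := by linarith
  have h4 := pow_le_pow_left₀ (by positivity) h3 2
  rw [mul_pow, sq_sqrt (by positivity), div_mul_eq_mul_div, div_le_iff₀ hθ] at h4
  linarith

/-- Lower bound (3.3): with `R_u = u^{-2/H'}`, `δ_u = (ln u)²/u²`, for the rectangles
`J'_{k,l} = [1+(l-1-k)R_u, 1+(l-k)R_u] × [(l-1)R_u, lR_u]` and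
`u_{k+} = u/(1-(H+ε)(k+1)R_u)`, for all large `u`:
`P(max_{J'_{k,l}} Y_H > u) ≥ (1/2-ε)^{1/H} 𝓗_{2H}² u_{k+}^{2/H} R_u² Ψ(u_{k+})`. -/
theorem shepp_fbm_rectangle_lower_bound
    {Ω : Type*} [MeasurableSpace Ω] (μ : Measure Ω) [IsProbabilityMeasure μ]
    (H : ℝ) (hH : H ∈ Set.Ioo (0:ℝ) (1/2))
    (B : ℝ → Ω → ℝ)
    (hmeas : ∀ t : ℝ, Measurable (B t))
    (hzero : ∀ ω, B 0 ω = 0)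
    (hcont : ∀ᵐ ω ∂μ, Continuous fun t => B t ω)
    (hgauss : ∀ (n : ℕ) (c : Fin n → ℝ) (t : Fin n → ℝ),
      ∃ v : NNReal, μ.map (fun ω => ∑ i, c i * B (t i) ω) =
        ProbabilityTheory.gaussianReal 0 v)
    (hcov : ∀ t s : ℝ, 0 ≤ t → 0 ≤ s →
      ∫ ω, B t ω * B s ω ∂μ = (t ^ (2*H) + s ^ (2*H) - |t - s| ^ (2*H)) / 2)
    (HH : ℝ) (hHH : 0 < HH)
    (hPick : Tendsto (fun lam : ℝ => lam⁻¹ *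
        ∫ ω, Real.exp (⨆ t : Set.Icc (0:ℝ) lam,
          (Real.sqrt 2 * B (t:ℝ) ω - (t:ℝ) ^ (2*H))) ∂μ) atTop (nhds HH))
    (ε : ℝ) (hε : ε ∈ Set.Ioo (0:ℝ) H)
    (H' : ℝ) (hH' : H' ∈ Set.Ioo (2*H) 1) (T : ℝ) (hT : 0 < T) :
    ∀ᶠ u : ℝ in atTop, ∀ k l : ℤ,
      1 ≤ l → (l : ℝ) ≤ T / u ^ (-(2:ℝ)/H') →
      1 ≤ k → (k : ℝ) ≤ ((Real.log u)^2 / u^2) / u ^ (-(2:ℝ)/H') - 1 →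
      (1/2 - ε) ^ (1/H) * HH ^ 2 *
          (u / (1 - (H + ε) * ((k : ℝ) + 1) * u ^ (-(2:ℝ)/H'))) ^ (2/H) *
          (u ^ (-(2:ℝ)/H'))^2 *
          stdNormalTail (u / (1 - (H + ε) * ((k : ℝ) + 1) * u ^ (-(2:ℝ)/H'))) ≤
      (μ {ω | u < supYOnRect B
            (1 + ((l : ℝ) - 1 - (k : ℝ)) * u ^ (-(2:ℝ)/H'))
            (1 + ((l : ℝ) - (k : ℝ)) * u ^ (-(2:ℝ)/H'))
            (((l : ℝ) - 1) * u ^ (-(2:ℝ)/H'))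
            ((l : ℝ) * u ^ (-(2:ℝ)/H')) ω}).toReal := by
  obtain ⟨hH0, hH2⟩ := hH
  obtain ⟨hε0, hεH⟩ := hε
  obtain ⟨hH'1, hH'2⟩ := hH'
  have hB : IsFbm μ H B := ⟨hmeas, hcont, hgauss, hcov⟩
  set c := (1 - 2 * ε) ^ (1/H) with hc
  have hc0 : 0 ≤ c := rpow_nonneg (by linarith) _
  have hc1 : c < 1 := rpow_lt_one (by linarith) (by linarith) (by positivity)
  obtain ⟨θ, hcθ, hθ1⟩ := exists_between hc1
  obtain ⟨a, ha, m, G, hG, K, hK0, hK, hparam⟩ := exists_grid_params hB hH0 hHH hPick hθ1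
  obtain ⟨ρ, hρ, V, hV⟩ := exists_rect_lower_bound hB hH0 hH2 ha hG hK0 hK
  have hp : 0 < a * (m + G) := by positivity
  set y₀ := a * (m + G) / (1 - √(c / θ)) with hy₀
  have hgrowth : Tendsto (fun u : ℝ => u ^ (1/H - 2/H')) atTop atTop := by
    refine tendsto_rpow_atTop (sub_pos.2 ?_)
    rw [div_lt_div_iff₀ (by linarith) hH0]
    linarith
  have hδ := tendsto_log_sq_div_sq.eventually_le_const
    (show 0 < min (ρ / 2) (min (1/2) (ε / (H + ε))) by positivity)
  filter_upwards [hδ, eventually_ge_atTop 1, eventually_ge_atTop V,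
    hgrowth.eventually_ge_atTop (y₀ * 2 ^ (1 / (2*H)))] with u hδu hu1 huV huy k l hl _ hk hkδ
  have hu0 : 0 < u := by linarith
  set R := u ^ (-(2:ℝ)/H') with hR
  have hR0 : 0 < R := rpow_pos_of_pos hu0 _
  have hl' : (1 : ℝ) ≤ l := by exact_mod_cast hl
  have hk' : (1 : ℝ) ≤ k := by exact_mod_cast hk
  have hx := (le_sub_iff_add_le.1 hkδ)
  rw [le_div_iff₀ hR0] at hx
  obtain ⟨hx1, hx2⟩ := le_min_iff.1 (hx.trans hδu)
  obtain ⟨hx2, hx3⟩ := le_min_iff.1 hx2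
  rw [show (H + ε) * ((k : ℝ) + 1) * R = (H + ε) * (((k : ℝ) + 1) * R) by ring]
  set x := ((k : ℝ) + 1) * R with hxdef
  have hx0 : 0 ≤ x := by positivity
  have hkR : (k : ℝ) * R = x - R := by rw [hxdef]; ring
  have hRk : R ≤ k * R := le_mul_of_one_le_left hR0.le hk'
  have hden : 0 < 1 - (H + ε) * x := by nlinarith
  set v := u / (1 - (H + ε) * x) with hv
  have huv : u ≤ v := by
    rw [hv, le_div_iff₀ hden]
    exact mul_le_of_le_one_right hu0.le (by nlinarith)
  have hv0 : 0 < v := hu0.trans_le huv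
  set q := 2 ^ (1 / (2*H)) * v ^ (-(1/H)) with hq
  have hq0 : 0 < q := by positivity
  have hvq : v ^ 2 * q ^ (2*H) = 2 := by
    rw [hq, mul_rpow (by positivity) (by positivity), ← rpow_mul (by norm_num),
      ← rpow_mul hv0.le, one_div_mul_cancel (by positivity), rpow_one,
      show -(1/H) * (2*H) = -((2:ℕ):ℝ) by field_simp; norm_num, rpow_neg hv0.le, rpow_natCast]
    field_simp
  set y := R / q with hy
  have hy0 : y₀ ≤ y := by
    rw [hy, le_div_iff₀ hq0, hq, rpow_neg hv0.le, ← mul_assoc, ← div_eq_mul_inv,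
      div_le_iff₀ (by positivity)]
    refine huy.trans ?_
    rw [rpow_sub hu0, hR, neg_div, rpow_neg hu0.le, div_eq_mul_inv, mul_comm]
    gcongr
  have hfloor := mul_sq_le_floor_sq hc0 hcθ hp hy0
  set n := ⌊y / (a * (m + G))⌋₊ with hn
  have hnR : q * a * (n * (m + G)) ≤ R := by
    have h1 : (n : ℝ) ≤ y / (a * (m + G)) := Nat.floor_le (by positivity)
    rw [le_div_iff₀ hp, hy, le_div_iff₀ hq0] at h1
    linarith
  have hlR : 0 ≤ ((l : ℝ) - 1) * R := mul_nonneg (by linarith) hR0.le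
  have ht₀ : 1 + ((l : ℝ) - 1 - k) * R - (l - 1) * R = 1 - k * R := by ring
  have hmain := hV v (huV.trans huv) (1 + ((l : ℝ) - 1 - k) * R) ((l - 1) * R) R u q
    (by linarith) hlR hR0.le
    (by
      rw [ht₀, sub_sub_cancel_left, abs_neg, abs_of_nonneg (by positivity)]
      linarith)
    (by
      have h1 : 1 + ((l : ℝ) - 1 - k) * R - R - (l - 1) * R = 1 - x := by
        rw [hxdef]; ring
      rw [h1]
      calc u = v * (1 - (H + ε) * x) := by rw [hv, div_mul_cancel₀ _ hden.ne']
        _ ≤ _ := mul_le_mul_of_nonneg_left (one_sub_le_rpow hH0 hε0 hx0 hx3) hv0.le)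
    hq0.le hvq n hnR
  rw [show 1 + ((l : ℝ) - 1 - k) * R + R = 1 + ((l : ℝ) - k) * R by ring,
    show ((l : ℝ) - 1) * R + R = l * R by ring] at hmain
  refine le_trans (mul_le_mul_of_nonneg_right ?_ (stdNormalTail_pos v).le) hmain
  have hcy : (1/2 - ε) ^ (1/H) * v ^ (2/H) * R ^ 2 = c * y ^ 2 := by
    have h1 : q ^ 2 = 2 ^ (1/H) * (v ^ (2/H))⁻¹ := by
      rw [hq, mul_pow, ← rpow_natCast, ← rpow_natCast, ← rpow_mul (by norm_num),
        ← rpow_mul hv0.le, ← rpow_neg hv0.le]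
      congr 2 <;> push_cast <;> field_simp
    have h2 : (1 - 2 * ε) ^ (1/H) = 2 ^ (1/H) * (1/2 - ε) ^ (1/H) := by
      rw [← mul_rpow (by norm_num) (by linarith)]
      congr 1
      ring
    rw [hc, h2, hy, div_pow, h1]
    field_simp
  calc (1/2 - ε) ^ (1/H) * HH ^ 2 * v ^ (2/H) * R ^ 2
      = HH ^ 2 * ((1/2 - ε) ^ (1/H) * v ^ (2/H) * R ^ 2) := by ring
    _ ≤ HH ^ 2 * ((n : ℝ) ^ 2 * (θ * (a * (m + G)) ^ 2)) := by
      rw [hcy]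
      gcongr
    _ = (n : ℝ) ^ 2 * (θ * HH ^ 2 * (a * (m + G)) ^ 2) := by ring
    _ ≤ _ := mul_le_mul_of_nonneg_left hparam (by positivity)
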